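/- Let L be a positive definite even lattice of rank n with n even. Then the theta series Θ_L(τ) = Σ_{v ∈ L} exp(πi (v,v) τ) converges absolutely and locally uniformly on the complex upper half-plane, and there exists a natural number N ≥ 1 such that Θ_L is a modular form of weight n/2 for the principal congruence subgroup Γ(N) of SL₂(ℤ): Θ_L is holomorphic on the upper half-plane, satisfies Θ_L((aτ+b)/(cτ+d)) = (cτ+d)^{n/2} Θ_L(τ) for all matrices [[a,b],[c,d]] ∈ Γ(N), and is holomorphic at the cusps. -/

import Mathlib

open scoped BigOperators

noncomputable section

/-- The group `ℚ/ℤ`. -/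
abbrev QmodZ : Type := ℚ ⧸ AddSubgroup.zmultiples (1 : ℚ)

/-- The group `ℚ/2ℤ`. -/
abbrev Qmod2Z : Type := ℚ ⧸ AddSubgroup.zmultiples (2 : ℚ)

/-- The isomorphism `ℚ/2ℤ → ℚ/ℤ` induced by dividing by `2`. -/
noncomputable def halfHom : Qmod2Z →+ QmodZ :=
  QuotientAddGroup.map _ _ (AddMonoidHom.mk' (fun x : ℚ => x / 2) (fun a b => add_div a b 2))
    (by
      intro x hx
      obtain ⟨k, rfl⟩ := AddSubgroup.mem_zmultiples_iff.mp hx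
      refine AddSubgroup.mem_zmultiples_iff.mpr ⟨k, ?_⟩
      show k • (1:ℚ) = (k • (2:ℚ)) / 2
      push_cast [zsmul_eq_mul]
      ring)

/-- The bilinear form `b(x,y) = (q(x+y) - q(x) - q(y))/2 ∈ ℚ/ℤ` associated to
`q : A → ℚ/2ℤ`. -/
def bForm {A : Type*} [AddCommGroup A] (q : A → Qmod2Z) (x y : A) : QmodZ :=
  halfHom (q (x + y) - q x - q y)

/-- `q : A → ℚ/2ℤ` is a finite quadratic space structure on the finite abelian group `A`
if the associated form `b` is `ℤ`-bilinear (i.e. biadditive) and nondegenerate. -/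
structure IsFiniteQuadraticSpace {A : Type*} [AddCommGroup A] [Finite A]
    (q : A → Qmod2Z) : Prop where
  add_left : ∀ x x' y, bForm q (x + x') y = bForm q x y + bForm q x' y
  add_right : ∀ x y y', bForm q x (y + y') = bForm q x y + bForm q x y'
  nondeg : ∀ x, (∀ y, bForm q x y = 0) → x = 0

/-- Two quadratic forms are isometric if some group isomorphism carries one to the other. -/
def FQSIsometric {A B : Type*} [AddCommGroup A] [AddCommGroup B]
    (qA : A → Qmod2Z) (qB : B → Qmod2Z) : Prop :=
  ∃ e : A ≃+ B, ∀ x, qB (e x) = qA x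

/-- An even lattice, given by its rank and Gram matrix: the Gram matrix is symmetric,
has even diagonal (so `(x,x)` is always even) and is nondegenerate. -/
structure EvenLattice : Type where
  n : ℕ
  B : Matrix (Fin n) (Fin n) ℤ
  symm : B.IsSymm
  even_diag : ∀ i, 2 ∣ B i i
  nondeg : B.det ≠ 0

/-- The bilinear form of `L` extended to `R^n` for any commutative ring `R ⊇ ℤ`. -/
def formR (L : EvenLattice) (R : Type*) [CommRing R] (x y : Fin L.n → R) : R :=
  ∑ i, ∑ j, (L.B i j : R) * x i * y j

theorem formR_zero_left (L : EvenLattice) (R : Type*) [CommRing R] (y : Fin L.n → R) :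
    formR L R 0 y = 0 := by
  simp [formR]

theorem formR_add_left (L : EvenLattice) (R : Type*) [CommRing R] (x x' y : Fin L.n → R) :
    formR L R (x + x') y = formR L R x y + formR L R x' y := by
  simp [formR, mul_add, add_mul, Finset.sum_add_distrib]

theorem formR_neg_left (L : EvenLattice) (R : Type*) [CommRing R] (x y : Fin L.n → R) :
    formR L R (-x) y = -formR L R x y := by
  simp [formR, Finset.sum_neg_distrib]

/-- `L` and `M` are isometric over `R`. -/
def IsometricOver (R : Type*) [CommRing R] (L M : EvenLattice) : Prop :=
  ∃ e : (Fin L.n → R) ≃ₗ[R] (Fin M.n → R), ∀ x y, formR M R (e x) (e y) = formR L R x y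

/-- `L` and `M` lie in the same genus: they are isometric over `ℤ_p` for all primes `p`
and over `ℝ`. -/
def SameGenus (L M : EvenLattice) : Prop :=
  (∀ (p : ℕ) [Fact p.Prime], IsometricOver ℤ_[p] L M) ∧ IsometricOver ℝ L M

/-- The subgroup of integral vectors in `ℚ^n`, i.e. the lattice `L` itself inside `L ⊗ ℚ`. -/
def intSub (L : EvenLattice) : AddSubgroup (Fin L.n → ℚ) where
  carrier := {x | ∀ i, ∃ m : ℤ, x i = m}
  zero_mem' := fun i => ⟨0, by simp⟩
  add_mem' := by
    intro x y hx hy i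
    obtain ⟨mx, hmx⟩ := hx i
    obtain ⟨my, hmy⟩ := hy i
    exact ⟨mx + my, by simp [hmx, hmy]⟩
  neg_mem' := by
    intro x hx i
    obtain ⟨m, hm⟩ := hx i
    exact ⟨-m, by simp [hm]⟩

/-- The dual lattice of a subgroup `K` of `L ⊗ ℚ`:
all vectors pairing integrally with every element of `K`. -/
def dualOf (L : EvenLattice) (K : AddSubgroup (Fin L.n → ℚ)) : AddSubgroup (Fin L.n → ℚ) where
  carrier := {x | ∀ y ∈ K, ∃ m : ℤ, formR L ℚ x y = m}
  zero_mem' := fun y _ => ⟨0, by simp [formR_zero_left]⟩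
  add_mem' := by
    intro x x' hx hx' y hy
    obtain ⟨m, hm⟩ := hx y hy
    obtain ⟨m', hm'⟩ := hx' y hy
    exact ⟨m + m', by rw [formR_add_left, hm, hm']; push_cast; ring⟩
  neg_mem' := by
    intro x hx y hy
    obtain ⟨m, hm⟩ := hx y hy
    exact ⟨-m, by rw [formR_neg_left, hm]; push_cast; ring⟩

/-- The dual lattice `L^*` of `L`. -/
abbrev dualSub (L : EvenLattice) : AddSubgroup (Fin L.n → ℚ) := dualOf L (intSub L)

/-- The discriminant group `K^*/K` of a subgroup `K` of `L ⊗ ℚ`. -/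
abbrev discGroupOf (L : EvenLattice) (K : AddSubgroup (Fin L.n → ℚ)) : Type :=
  dualOf L K ⧸ K.addSubgroupOf (dualOf L K)

/-- The discriminant group `L^*/L`. -/
abbrev discGroup (L : EvenLattice) : Type := discGroupOf L (intSub L)

/-- The discriminant form on `K^*/K`, `q(x + K) = (x,x) mod 2ℤ`
(defined via a choice of representative; it is independent of this choice). -/
noncomputable def discQOf (L : EvenLattice) (K : AddSubgroup (Fin L.n → ℚ)) :
    discGroupOf L K → Qmod2Z :=
  fun a => (QuotientAddGroup.mk (formR L ℚ (a.out : Fin L.n → ℚ) (a.out : Fin L.n → ℚ)) : Qmod2Z)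

/-- The discriminant form `q_L` on `L^*/L`. -/
noncomputable def discQ (L : EvenLattice) : discGroup L → Qmod2Z := discQOf L (intSub L)

/-- `n₊`: the maximal dimension of a positive definite subspace of `L ⊗ ℝ`. -/
noncomputable def sigPlus (L : EvenLattice) : ℕ :=
  sSup {d : ℕ | ∃ W : Submodule ℝ (Fin L.n → ℝ), Module.finrank ℝ W = d ∧
    ∀ x ∈ W, x ≠ 0 → 0 < formR L ℝ x x}

/-- `n₋`: the maximal dimension of a negative definite subspace of `L ⊗ ℝ`. -/
noncomputable def sigMinus (L : EvenLattice) : ℕ :=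
  sSup {d : ℕ | ∃ W : Submodule ℝ (Fin L.n → ℝ), Module.finrank ℝ W = d ∧
    ∀ x ∈ W, x ≠ 0 → formR L ℝ x x < 0}

end

open UpperHalfPlane Filter

/-- The theta series of a lattice `L`, `Θ_L(τ) = Σ_{v ∈ L} exp(πi (v,v) τ)`. -/
noncomputable def thetaSeries (L : EvenLattice) (τ : UpperHalfPlane) : ℂ :=
  ∑' v : Fin L.n → ℤ, Complex.exp (Real.pi * Complex.I * ((formR L ℤ v v : ℤ) : ℂ) * (τ : ℂ))


namespace ThetaAux

open MeasureTheory Complex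

/-- Product-type functions are summable. -/
lemma summable_pi_prod {n : ℕ} (g : ℤ → ℝ) (h0 : ∀ m, 0 ≤ g m) (hg : Summable g) :
    Summable (fun v : Fin n → ℤ => ∏ i, g (v i)) := by
  classical
  refine summable_of_sum_le (c := ∏ _i : Fin n, ∑' m, g m)
    (fun v => Finset.prod_nonneg fun i _ => h0 _) ?_
  intro s
  have hsub : s ⊆ Fintype.piFinset (fun i => s.image (fun v => v i)) := by
    intro v hv
    rw [Fintype.mem_piFinset]
    intro i
    exact Finset.mem_image_of_mem (fun v : Fin n → ℤ => v i) hv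
  calc ∑ v ∈ s, ∏ i, g (v i)
      ≤ ∑ v ∈ Fintype.piFinset (fun i => s.image (fun v => v i)), ∏ i, g (v i) :=
        Finset.sum_le_sum_of_subset_of_nonneg hsub
          (fun v _ _ => Finset.prod_nonneg fun i _ => h0 _)
    _ = ∏ i, ∑ m ∈ s.image (fun v => v i), g m := by
        rw [Finset.prod_univ_sum]
    _ ≤ ∏ _i : Fin n, ∑' m, g m :=
        Finset.prod_le_prod (fun i _ => Finset.sum_nonneg fun m _ => h0 m)
          (fun i _ => hg.sum_le_tsum _ (fun m _ => h0 m))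

lemma summable_gauss_int (a : ℝ) (ha : 0 < a) :
    Summable (fun m : ℤ => Real.exp (-a * (m : ℝ) ^ 2)) := by
  have h := (summable_pow_mul_jacobiTheta₂_term_bound 0 (T := a / Real.pi)
    (by positivity) 0)
  refine h.congr ?_
  intro m
  simp
  field_simp

lemma summable_gauss {n : ℕ} (a : ℝ) (ha : 0 < a) :
    Summable (fun v : Fin n → ℤ => Real.exp (-a * ∑ i, (v i : ℝ) ^ 2)) := by
  refine (summable_pi_prod (n := n) _ (fun m => (Real.exp_pos _).le)
    (summable_gauss_int a ha)).congr ?_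
  intro v
  rw [← Real.exp_sum, Finset.mul_sum]

/-- The periodization is summable. -/
lemma summable_shift {n : ℕ} (f : (Fin n → ℝ) → ℂ)
    (hb : ∀ R : ℝ, ∃ g : (Fin n → ℤ) → ℝ, Summable g ∧
      ∀ (x : Fin n → ℝ) (w : Fin n → ℤ), (∀ i, |x i| ≤ R) → ‖f (fun i => x i + w i)‖ ≤ g w)
    (x : Fin n → ℝ) : Summable (fun w : Fin n → ℤ => f (fun i => x i + w i)) := by
  obtain ⟨g, hg, h⟩ := hb ‖x‖
  exact Summable.of_norm_bounded hg (fun w => h x w (fun i => norm_le_pi_norm x i))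

lemma continuous_period {n : ℕ} (f : (Fin n → ℝ) → ℂ) (hf : Continuous f)
    (hb : ∀ R : ℝ, ∃ g : (Fin n → ℤ) → ℝ, Summable g ∧
      ∀ (x : Fin n → ℝ) (w : Fin n → ℤ), (∀ i, |x i| ≤ R) → ‖f (fun i => x i + w i)‖ ≤ g w) :
    Continuous (fun x : Fin n → ℝ => ∑' w : Fin n → ℤ, f (fun i => x i + w i)) := by
  rw [continuous_iff_continuousAt]
  intro x₀
  obtain ⟨g, hg, h⟩ := hb (‖x₀‖ + 1)
  have hc : ContinuousOn (fun x : Fin n → ℝ => ∑' w : Fin n → ℤ, f (fun i => x i + w i))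
      (Metric.ball x₀ 1) := by
    refine continuousOn_tsum (fun w => ?_) hg (fun w x hx => h x w (fun i => ?_))
    · exact (hf.comp (by fun_prop)).continuousOn
    · have h1 : ‖x i‖ ≤ ‖x‖ := norm_le_pi_norm x i
      have h2 : ‖x - x₀‖ < 1 := by simpa [dist_eq_norm] using hx
      have h3 : ‖x‖ ≤ ‖x₀‖ + ‖x - x₀‖ := by
        calc ‖x‖ = ‖x₀ + (x - x₀)‖ := by congr 1; abel
          _ ≤ _ := norm_add_le _ _
      rw [Real.norm_eq_abs] at h1
      linarith
  exact hc.continuousAt (Metric.ball_mem_nhds _ one_pos)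

/-- The unit box. -/
def box (n : ℕ) : Set (Fin n → ℝ) := {x | ∀ i, x i ∈ Set.Ioc (0 : ℝ) (0 + 1)}

lemma measurableSet_box (n : ℕ) : MeasurableSet (box n) :=
  MeasurableSet.univ_pi' (fun _ => measurableSet_Ioc)

lemma volume_box_lt_top (n : ℕ) : volume (box n) < ⊤ := by
  have : box n ⊆ Set.Icc 0 1 := by
    intro x hx
    exact ⟨fun i => (hx i).1.le, fun i => by simpa using (hx i).2⟩
  exact lt_of_le_of_lt (measure_mono this) isCompact_Icc.measure_lt_top

/-- Unfolding. -/
lemma integral_unfold {n : ℕ} (f : (Fin n → ℝ) → ℂ) (hf : Continuous f)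
    (hb : ∃ g : (Fin n → ℤ) → ℝ, Summable g ∧
      ∀ (x : Fin n → ℝ) (w : Fin n → ℤ), (∀ i, |x i| ≤ 1) → ‖f (fun i => x i + w i)‖ ≤ g w) :
    ∫ x in box n, ∑' w : Fin n → ℤ, f (fun i => x i + w i) = ∫ x, f x := by
  obtain ⟨g, hg, h⟩ := hb
  set c : (Fin n → ℤ) → (Fin n → ℝ) := fun w i => (w i : ℝ) with hc
  have hfc : ∀ (w : Fin n → ℤ) (x : Fin n → ℝ), f (fun i => x i + w i) = f (x + c w) :=
    fun w x => rfl
  have hbox : ∀ x ∈ box n, ∀ i, |x i| ≤ 1 := by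
    intro x hx i
    have := hx i
    rw [abs_le]
    constructor <;> [linarith [this.1]; linarith [this.2]]
  have hIntg : ∀ w, IntegrableOn (fun x => f (x + c w)) (box n) := by
    intro w
    refine IntegrableOn.of_bound (volume_box_lt_top n)
      (hf.comp (by fun_prop)).aestronglyMeasurable (g w) ?_
    filter_upwards [ae_restrict_mem (measurableSet_box n)] with x hx
    exact h x w (hbox x hx)
  have hnorm : Summable fun w => ∫ x in box n, ‖f (x + c w)‖ := by
    refine Summable.of_nonneg_of_le (fun w => integral_nonneg fun x => norm_nonneg _)
      (fun w => ?_) (hg.mul_right (volume.real (box n)))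
    have := norm_setIntegral_le_of_norm_le_const (f := fun x => ‖f (x + c w)‖) (C := g w)
      (μ := volume) (volume_box_lt_top n)
      (fun x hx => by rw [norm_norm]; exact h x w (hbox x hx))
    exact le_trans (Real.le_norm_self _) this
  let s : (Fin n → ℤ) → Set (Fin n → ℝ) := fun w => {x | x - c w ∈ box n}
  have hs : ∀ w, MeasurableSet (s w) := fun w =>
    (measurable_id.sub_const (c w)) (measurableSet_box n)
  have htr : ∀ {E : Type} [NormedAddCommGroup E] [NormedSpace ℝ E] (F : (Fin n → ℝ) → E)
      (w : Fin n → ℤ), ∫ x in s w, F x = ∫ x in box n, F (x + c w) := by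
    intro E _ _ F w
    rw [← integral_indicator (hs w), ← integral_indicator (measurableSet_box n),
      ← integral_add_right_eq_self _ (c w)]
    congr 1
    ext x
    have : x + c w ∈ s w ↔ x ∈ box n := by
      show x + c w - c w ∈ box n ↔ x ∈ box n
      rw [add_sub_cancel_right]
    by_cases hx : x ∈ box n
    · rw [Set.indicator_of_mem hx, Set.indicator_of_mem (this.mpr hx)]
    · rw [Set.indicator_of_notMem hx, Set.indicator_of_notMem (fun h => hx (this.mp h))]
  have hts : ∀ w, IntegrableOn f (s w) := by
    intro w
    rw [← integrable_indicator_iff (hs w)]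
    have := (hIntg w)
    rw [← (integrable_indicator_iff (measurableSet_box n))] at this
    have := this.comp_sub_right (c w)
    refine this.congr (Filter.Eventually.of_forall fun x => ?_)
    have : x ∈ s w ↔ x - c w ∈ box n := Iff.rfl
    beta_reduce
    by_cases hx : x - c w ∈ box n
    · rw [Set.indicator_of_mem hx, Set.indicator_of_mem (this.mpr hx), sub_add_cancel]
    · rw [Set.indicator_of_notMem hx, Set.indicator_of_notMem (fun h => hx (this.mp h))]
  have hdisj : Pairwise (Function.onFun Disjoint s) := by
    intro w w' hne
    rw [Function.onFun, Set.disjoint_left]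
    intro x hx hx'
    apply hne
    funext i
    have h1 := hx i
    have h2 := hx' i
    simp only [hc, Pi.sub_apply, Set.mem_Ioc] at h1 h2
    have h3 : (w i : ℝ) < w' i + 1 := by linarith
    have h4 : (w' i : ℝ) < w i + 1 := by linarith
    norm_cast at h3 h4
    omega
  have hun : (⋃ w, s w) = Set.univ := by
    rw [Set.eq_univ_iff_forall]
    intro x
    rw [Set.mem_iUnion]
    refine ⟨fun i => ⌈x i⌉ - 1, fun i => ?_⟩
    simp only [hc, Pi.sub_apply, Set.mem_Ioc]
    push_cast
    constructor <;> [linarith [Int.ceil_lt_add_one (x i)]; linarith [Int.le_ceil (x i)]]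
  have hI : IntegrableOn f (⋃ w, s w) := by
    refine integrableOn_iUnion_of_summable_integral_norm hts ?_
    refine hnorm.congr (fun w => ?_)
    rw [htr]
  have e1 := hasSum_integral_iUnion hs hdisj hI
  rw [hun, Measure.restrict_univ] at e1
  have e2 := hasSum_integral_of_summable_integral_norm (μ := volume.restrict (box n))
    (F := fun w x => f (x + c w)) hIntg hnorm
  simp only [htr] at e1
  exact e2.unique e1

/-- Poisson summation in `n` dimensions. -/
theorem poisson {n : ℕ} (f : (Fin n → ℝ) → ℂ) (hf : Continuous f)
    (hb : ∀ R : ℝ, ∃ g : (Fin n → ℤ) → ℝ, Summable g ∧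
      ∀ (x : Fin n → ℝ) (w : Fin n → ℤ), (∀ i, |x i| ≤ R) → ‖f (fun i => x i + w i)‖ ≤ g w)
    (fh : (Fin n → ℤ) → ℂ) (hfh : Summable fh)
    (hfh' : ∀ u : Fin n → ℤ, fh u = ∫ x : Fin n → ℝ,
      cexp (-(2 * Real.pi * Complex.I) * ∑ i, (u i : ℂ) * x i) * f x) (x : Fin n → ℝ) :
    ∑' w : Fin n → ℤ, f (fun i => x i + w i) =
      ∑' u : Fin n → ℤ, fh u * cexp (2 * Real.pi * Complex.I * ∑ i, (u i : ℂ) * x i) := by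
  set S : (Fin n → ℝ) → ℂ := fun x => ∑' w : Fin n → ℤ, f (fun i => x i + w i) with hS
  have hScont : Continuous S := continuous_period f hf hb
  have hper : ∀ (x : Fin n → ℝ) (m : Fin n → ℤ), S (fun i => x i + m i) = S x := by
    intro x m
    simp only [hS]
    rw [← (Equiv.addLeft m).tsum_eq (fun w : Fin n → ℤ => f (fun i => x i + w i))]
    congr 1
    ext w
    congr 1
    ext i
    simp [add_assoc]
  let mk : (Fin n → ℝ) → UnitAddTorus (Fin n) := fun x i => (x i : UnitAddCircle)
  have hmk : Topology.IsQuotientMap mk := by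
    have := IsOpenQuotientMap.piMap (ι := Fin n) (f := fun _ (x : ℝ) => (x : UnitAddCircle))
      (fun i => QuotientAddGroup.isOpenQuotientMap_mk)
    exact this.isQuotientMap
  let F0 : UnitAddTorus (Fin n) → ℂ := fun t => S (fun i => (AddCircle.equivIoc 1 0 (t i) : ℝ))
  have hF0 : ∀ x, F0 (mk x) = S x := by
    intro x
    have : ∀ i, ∃ m : ℤ, (AddCircle.equivIoc 1 0 (mk x i) : ℝ) = x i + m := by
      intro i
      have h1 : (((AddCircle.equivIoc (1:ℝ) 0 (mk x i) : ℝ)) : UnitAddCircle) = (x i : UnitAddCircle) :=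
        AddCircle.coe_equivIoc
      rw [← sub_eq_zero, ← AddCircle.coe_sub, AddCircle.coe_eq_zero_iff] at h1
      obtain ⟨m, hm⟩ := h1
      exact ⟨m, by simp at hm; linarith⟩
    choose m hm using this
    simp only [F0, hm]
    exact hper x m
  have hF0c : Continuous F0 := by
    rw [hmk.continuous_iff]
    exact hScont.congr (fun x => (hF0 x).symm)
  let F : C(UnitAddTorus (Fin n), ℂ) := ⟨F0, hF0c⟩
  have hmf : ∀ (u : Fin n → ℤ) (x : Fin n → ℝ), UnitAddTorus.mFourier u (mk x) =
      cexp (2 * Real.pi * Complex.I * ∑ i, (u i : ℂ) * x i) := by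
    intro u x
    simp only [UnitAddTorus.mFourier, ContinuousMap.coe_mk, mk, fourier_coe_apply]
    rw [← Complex.exp_sum, Finset.mul_sum]
    congr 1
    refine Finset.sum_congr rfl fun i _ => ?_
    push_cast
    ring
  have hcoef : ∀ u, UnitAddTorus.mFourierCoeff F u = fh u := by
    intro u
    rw [UnitAddTorus.mFourierCoeff_eq_integral F u 0, hfh']
    have h1 : ∀ x : Fin n → ℝ, UnitAddTorus.mFourier (-u) (fun i => (x i : UnitAddCircle)) •
        F (fun i => (x i : UnitAddCircle)) = ∑' w : Fin n → ℤ,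
          (fun x : Fin n → ℝ => cexp (-(2 * Real.pi * Complex.I) * ∑ i, (u i : ℂ) * x i) * f x)
            (fun i => x i + w i) := by
      intro x
      have h2 : F (fun i => (x i : UnitAddCircle)) = S x := hF0 x
      rw [h2, hmf (-u) x, smul_eq_mul, hS, ← tsum_mul_left]
      congr 1
      ext w
      dsimp only
      congr 1
      rw [Complex.exp_eq_exp_iff_exists_int]
      refine ⟨∑ i, u i * w i, ?_⟩
      push_cast
      simp only [mul_add, Finset.sum_add_distrib, Finset.mul_sum, Finset.sum_mul, Pi.neg_apply,
        Int.cast_neg]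
      rw [← Finset.sum_add_distrib, ← Finset.sum_add_distrib]
      refine Finset.sum_congr rfl fun i _ => ?_
      ring
    simp_rw [h1]
    refine integral_unfold (fun x : Fin n → ℝ =>
      cexp (-(2 * Real.pi * Complex.I) * ∑ i, (u i : ℂ) * x i) * f x) (by fun_prop) ?_
    obtain ⟨g, hg, h⟩ := hb 1
    refine ⟨g, hg, fun x w hx => ?_⟩
    rw [norm_mul]
    have : ‖cexp (-(2 * Real.pi * Complex.I) * ∑ i, (u i : ℂ) * ((x i + w i : ℝ) : ℂ))‖ = 1 := by
      have : -(2 * Real.pi * Complex.I) * ∑ i, (u i : ℂ) * ((x i + w i : ℝ) : ℂ) =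
        ((-(2 * Real.pi) * ∑ i, (u i : ℝ) * (x i + w i) : ℝ) : ℂ) * Complex.I := by
        push_cast; ring
      rw [this, Complex.norm_exp_ofReal_mul_I]
    rw [this, one_mul]
    exact h x w hx
  have hsum : Summable (UnitAddTorus.mFourierCoeff F) := by
    refine hfh.congr fun u => (hcoef u).symm
  have := UnitAddTorus.hasSum_mFourier_series_apply_of_summable hsum (mk x)
  rw [show F (mk x) = S x from hF0 x] at this
  refine this.tsum_eq.symm.trans ?_
  congr 1
  ext u
  rw [hcoef, hmf, smul_eq_mul]

end ThetaAux


namespace ThetaAux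

open MeasureTheory Complex

/-- The quadratic form `|P x|^2`. -/
noncomputable def qP {n : ℕ} (P : Matrix (Fin n) (Fin n) ℝ) (x : Fin n → ℝ) : ℝ :=
  ∑ i, (P.mulVec x i) ^ 2

lemma qP_nonneg {n : ℕ} (P : Matrix (Fin n) (Fin n) ℝ) (x : Fin n → ℝ) : 0 ≤ qP P x :=
  Finset.sum_nonneg fun _ _ => sq_nonneg _

lemma continuous_qP {n : ℕ} (P : Matrix (Fin n) (Fin n) ℝ) : Continuous (qP P) := by
  unfold qP
  refine continuous_finsetSum _ fun i _ => ?_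
  exact ((continuous_apply i).comp (by fun_prop : Continuous fun x => P.mulVec x)).pow 2

lemma qP_le {n : ℕ} (P : Matrix (Fin n) (Fin n) ℝ) (x : Fin n → ℝ) :
    qP P x ≤ (∑ i, ∑ j, P i j ^ 2) * ∑ j, x j ^ 2 := by
  unfold qP
  rw [Finset.sum_mul]
  refine Finset.sum_le_sum fun i _ => ?_
  exact Finset.sum_mul_sq_le_sq_mul_sq Finset.univ (fun j => P i j) x

lemma qP_lower {n : ℕ} (P : Matrix (Fin n) (Fin n) ℝ) (hP : P.det ≠ 0) :
    ∃ ε > 0, ∀ x : Fin n → ℝ, ε * ∑ i, x i ^ 2 ≤ qP P x := by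
  set A := ∑ i, ∑ j, P⁻¹ i j ^ 2 with hA
  have hA0 : 0 ≤ A := Finset.sum_nonneg fun _ _ => Finset.sum_nonneg fun _ _ => sq_nonneg _
  refine ⟨(A + 1)⁻¹, by positivity, fun x => ?_⟩
  have h1 := qP_le P⁻¹ (P.mulVec x)
  have h2 : qP P⁻¹ (P.mulVec x) = ∑ i, x i ^ 2 := by
    unfold qP
    rw [Matrix.mulVec_mulVec, Matrix.nonsing_inv_mul _ (isUnit_iff_ne_zero.mpr hP),
      Matrix.one_mulVec]
  rw [h2] at h1
  rw [inv_mul_le_iff₀ (by positivity)]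
  have h3 : 0 ≤ qP P x := qP_nonneg P x
  have h4 : ∑ j, (P.mulVec x j) ^ 2 = qP P x := rfl
  rw [h4] at h1
  nlinarith

lemma norm_gauss {n : ℕ} (P : Matrix (Fin n) (Fin n) ℝ) (σ : ℂ) (x : Fin n → ℝ) :
    ‖cexp (Real.pi * Complex.I * σ * (qP P x : ℝ))‖ = Real.exp (-Real.pi * σ.im * qP P x) := by
  rw [Complex.norm_exp]
  congr 1
  simp

lemma gauss_bound {n : ℕ} (P : Matrix (Fin n) (Fin n) ℝ) (hP : P.det ≠ 0) (a : ℝ) (ha : 0 < a)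
    (R : ℝ) : ∃ g : (Fin n → ℤ) → ℝ, Summable g ∧
      ∀ (x : Fin n → ℝ) (w : Fin n → ℤ), (∀ i, |x i| ≤ R) →
        Real.exp (-a * qP P (fun i => x i + w i)) ≤ g w := by
  obtain ⟨ε, hε, h⟩ := qP_lower P hP
  refine ⟨fun w => Real.exp (a * ε * (n * R ^ 2)) * Real.exp (-(a * ε / 2) * ∑ i, (w i : ℝ) ^ 2),
    (summable_gauss _ (by positivity)).mul_left _, fun x w hx => ?_⟩
  beta_reduce
  rw [← Real.exp_add, Real.exp_le_exp]
  have h1 := h (fun i => x i + w i)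
  have h2 : (∑ i, (w i : ℝ) ^ 2) ≤ 2 * ∑ i, (x i + w i) ^ 2 + 2 * (n * R ^ 2) := by
    have : (n : ℝ) * R ^ 2 = ∑ _i : Fin n, R ^ 2 := by simp
    rw [this, Finset.mul_sum, Finset.mul_sum, ← Finset.sum_add_distrib]
    refine Finset.sum_le_sum fun i _ => ?_
    have h3 : x i ^ 2 ≤ R ^ 2 := by
      rw [← sq_abs (x i)]
      exact pow_le_pow_left₀ (abs_nonneg _) (hx i) 2
    nlinarith [sq_nonneg (2 * x i + w i)]
  have h4 : 0 < a * ε := by positivity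
  have h5 : a * (ε * ∑ i, (x i + w i) ^ 2) ≤ a * qP P (fun i => x i + w i) :=
    mul_le_mul_of_nonneg_left h1 ha.le
  nlinarith [mul_le_mul_of_nonneg_left h2 h4.le]

lemma summable_qP {n : ℕ} (P : Matrix (Fin n) (Fin n) ℝ) (hP : P.det ≠ 0) (a : ℝ) (ha : 0 < a) :
    Summable (fun w : Fin n → ℤ => Real.exp (-a * qP P (fun i => (w i : ℝ)))) := by
  obtain ⟨g, hg, h⟩ := gauss_bound P hP a ha 0
  refine Summable.of_nonneg_of_le (fun w => (Real.exp_pos _).le) (fun w => ?_) hg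
  simpa using h 0 w (by simp)

lemma gauss_integral {n : ℕ} (P : Matrix (Fin n) (Fin n) ℝ) (hP : P.det ≠ 0) (k : ℕ)
    (hk : n = 2 * k) (σ : ℂ) (hσ : 0 < σ.im) (u : Fin n → ℝ) :
    ∫ x : Fin n → ℝ, cexp (-(2 * Real.pi * Complex.I) * ∑ i, (u i : ℂ) * x i) *
        cexp (Real.pi * Complex.I * σ * (qP P x : ℝ)) =
      (|P.det⁻¹| : ℝ) * (Complex.I / σ) ^ k *
        cexp (Real.pi * Complex.I * (-1 / σ) * (qP (P⁻¹).transpose u : ℝ)) := by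
  have hσ0 : σ ≠ 0 := by
    rintro rfl
    simp at hσ
  set b : ℂ := -(Real.pi * Complex.I * σ) with hb
  have hbre : 0 < b.re := by
    simp [hb]
    positivity
  set v : Fin n → ℝ := (P⁻¹).transpose.mulVec u with hv
  set c : Fin n → ℂ := fun i => -(2 * Real.pi * Complex.I) * v i with hc
  let G : (Fin n → ℝ) → ℂ := fun y => cexp (-b * ∑ i, (y i : ℂ) ^ 2 + ∑ i, c i * y i)
  have hG : Continuous G := by fun_prop
  have huv : ∀ x : Fin n → ℝ, ∑ i, u i * x i = ∑ i, v i * P.mulVec x i := by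
    intro x
    have : v ⬝ᵥ P.mulVec x = u ⬝ᵥ x := by
      rw [hv, Matrix.mulVec_transpose, ← Matrix.dotProduct_mulVec, Matrix.mulVec_mulVec,
        Matrix.nonsing_inv_mul _ (isUnit_iff_ne_zero.mpr hP), Matrix.one_mulVec]
    exact this.symm
  have h1 : ∀ x : Fin n → ℝ, cexp (-(2 * Real.pi * Complex.I) * ∑ i, (u i : ℂ) * x i) *
        cexp (Real.pi * Complex.I * σ * (qP P x : ℝ)) = G (Matrix.toLin' P x) := by
    intro x
    have h2 : ∑ i, (u i : ℂ) * x i = ∑ i, (v i : ℂ) * (P.mulVec x i : ℝ) := by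
      have := congrArg (fun r : ℝ => (r : ℂ)) (huv x)
      push_cast at this
      exact this
    rw [h2, ← Complex.exp_add]
    simp only [G, Matrix.toLin'_apply]
    congr 1
    rw [add_comm]
    congr 1
    · simp [hb, qP]
    · simp only [hc, Finset.mul_sum]
      refine Finset.sum_congr rfl fun i _ => by ring
  simp_rw [h1]
  rw [← integral_map (φ := Matrix.toLin' P) (f := G)
    (LinearMap.continuous_of_finiteDimensional _).measurable.aemeasurable
    hG.aestronglyMeasurable, Real.map_matrix_volume_pi_eq_smul_volume_pi hP,
    integral_smul_measure, GaussianFourier.integral_cexp_neg_mul_sum_add hbre c]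
  rw [ENNReal.toReal_ofReal (abs_nonneg _), Complex.real_smul, mul_assoc]
  congr 2
  · have : (Real.pi : ℂ) / b = Complex.I / σ := by
      rw [hb]
      have : (Real.pi : ℂ) ≠ 0 := by exact_mod_cast Real.pi_ne_zero
      field_simp
      simp
    rw [this, Fintype.card_fin, hk]
    push_cast
    rw [mul_div_cancel_left₀ _ (two_ne_zero), Complex.cpow_natCast]
  · have h3 : ∑ i, c i ^ 2 = -(4 * Real.pi ^ 2) * (qP (P⁻¹).transpose u : ℝ) := by
      unfold qP
      push_cast
      rw [Finset.mul_sum]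
      refine Finset.sum_congr rfl fun i _ => ?_
      simp only [hc, hv]
      ring_nf
      simp
    rw [h3, hb]
    congr 1
    have : (Real.pi : ℂ) ≠ 0 := by exact_mod_cast Real.pi_ne_zero
    field_simp
    ring_nf
    simp

/-- The theta inversion formula. -/
theorem poisson_gauss {n : ℕ} (P : Matrix (Fin n) (Fin n) ℝ) (hP : P.det ≠ 0) (k : ℕ)
    (hk : n = 2 * k) (σ : ℂ) (hσ : 0 < σ.im) (x : Fin n → ℝ) :
    ∑' w : Fin n → ℤ, cexp (Real.pi * Complex.I * σ * (qP P (fun i => x i + w i) : ℝ)) =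
      (|P.det⁻¹| : ℝ) * (Complex.I / σ) ^ k * ∑' u : Fin n → ℤ,
        cexp (Real.pi * Complex.I * (-1 / σ) * (qP (P⁻¹).transpose (fun i => (u i : ℝ)) : ℝ)) *
          cexp (2 * Real.pi * Complex.I * ∑ i, (u i : ℂ) * x i) := by
  have hσ0 : σ ≠ 0 := by
    rintro rfl
    simp at hσ
  have hs : 0 < (-1 / σ).im := by
    simp [div_eq_mul_inv]
    have := Complex.normSq_pos.mpr hσ0
    positivity
  have hP' : (P⁻¹).transpose.det ≠ 0 := by
    rw [Matrix.det_transpose, Matrix.det_nonsing_inv, Ring.inverse_eq_inv']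
    exact inv_ne_zero hP
  have := poisson (fun x : Fin n → ℝ => cexp (Real.pi * Complex.I * σ * (qP P x : ℝ)))
    (by have := continuous_qP P; fun_prop) (fun R => by
      obtain ⟨g, hg, h⟩ := gauss_bound P hP (Real.pi * σ.im) (by positivity) R
      refine ⟨g, hg, fun x w hx => ?_⟩
      rw [norm_gauss]
      have := h x w hx
      rwa [← neg_mul] at this)
    (fun u => (|P.det⁻¹| : ℝ) * (Complex.I / σ) ^ k *
        cexp (Real.pi * Complex.I * (-1 / σ) * (qP (P⁻¹).transpose (fun i => (u i : ℝ)) : ℝ)))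
    (by
      refine Summable.mul_left _ ?_
      refine Summable.of_norm ?_
      simp_rw [norm_gauss, neg_mul, ← neg_mul (Real.pi * _)]
      exact summable_qP _ hP' _ (by positivity))
    (fun u => by
      rw [← gauss_integral P hP k hk σ hσ]
      simp only [ofReal_intCast]) x
  rw [this, ← tsum_mul_left]
  congr 1
  ext u
  ring

end ThetaAux


namespace ThetaAux

open Complex

/-- The root of unity `exp(2πi m/d)`. -/
noncomputable def ee (d : ℕ) (m : ℤ) : ℂ := cexp (2 * Real.pi * Complex.I * (m / d))

lemma ee_add (d : ℕ) (m m' : ℤ) : ee d (m + m') = ee d m * ee d m' := by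
  unfold ee
  rw [← Complex.exp_add]
  congr 1
  push_cast
  ring

lemma ee_mul_self (d : ℕ) (hd : 0 < d) (m : ℤ) : ee d (d * m) = 1 := by
  unfold ee
  rw [Complex.exp_eq_one_iff]
  refine ⟨m, ?_⟩
  have : (d : ℂ) ≠ 0 := by exact_mod_cast hd.ne'
  push_cast
  field_simp

lemma ee_congr (d : ℕ) (hd : 0 < d) {m m' : ℤ} (h : (d : ℤ) ∣ m - m') : ee d m = ee d m' := by
  obtain ⟨q, hq⟩ := h
  have : m = m' + d * q := by linarith
  rw [this, ee_add, ee_mul_self d hd, mul_one]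

lemma norm_ee (d : ℕ) (m : ℤ) : ‖ee d m‖ = 1 := by
  unfold ee
  have : 2 * Real.pi * Complex.I * ((m : ℂ) / d) = ((2 * Real.pi * (m / d) : ℝ) : ℂ) * Complex.I := by
    push_cast; ring
  rw [this, Complex.norm_exp_ofReal_mul_I]

lemma ee_eq_pow (d d1 : ℕ) (hd : 0 < d) (hd1 : 0 < d1) (m : ℤ) :
    ee d m = cexp (2 * Real.pi * Complex.I / ((d * d1 : ℕ) : ℂ)) ^ ((m % d).toNat * d1) := by
  have h0 : (0 : ℤ) ≤ m % d := Int.emod_nonneg _ (by omega)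
  rw [ee_congr d hd (m := m) (m' := m % d) (by
    rw [Int.emod_def]; exact ⟨m / d, by ring⟩)]
  unfold ee
  rw [← Complex.exp_nat_mul]
  congr 1
  have h1 : (((m % d).toNat : ℕ) : ℂ) = ((m % d : ℤ) : ℂ) := by
    rw [← Int.cast_natCast, Int.toNat_of_nonneg h0]
  have h2 : (d : ℂ) ≠ 0 := by exact_mod_cast hd.ne'
  have h3 : (d1 : ℂ) ≠ 0 := by exact_mod_cast hd1.ne'
  rw [Nat.cast_mul, h1]
  push_cast
  field_simp

lemma galois {ι κ : Type*} [Fintype ι] [Fintype κ] (d d1 : ℕ) (hd : 0 < d) (hd1 : 0 < d1)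
    (hcop : d.Coprime d1) (f : ι → ℤ) (g : κ → ℤ) (A B : ℤ) (hA : A ≠ 0)
    (h : (A : ℂ) * ∑ i, ee d (f i) = B * ∑ j, ee d1 (g j)) (t : ℤ) (ht : IsCoprime t d) :
    ∑ i, ee d (t * f i) = ∑ i, ee d (f i) := by
  open Polynomial in
  set ζ : ℂ := cexp (2 * Real.pi * Complex.I / ((d * d1 : ℕ) : ℂ)) with hζ
  have hprim : IsPrimitiveRoot ζ (d * d1) := Complex.isPrimitiveRoot_exp _ (by positivity)
  have hζ1 : ∀ m : ℤ, ee d m = ζ ^ ((m % d).toNat * d1) := ee_eq_pow d d1 hd hd1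
  have hζ2 : ∀ m : ℤ, ee d1 m = ζ ^ ((m % d1).toNat * d) := by
    intro m
    rw [hζ, mul_comm d d1]
    exact ee_eq_pow d1 d hd1 hd m
  let p : Polynomial ℤ := C A * ∑ i, X ^ ((f i % d).toNat * d1) -
    C B * ∑ j, X ^ ((g j % d1).toNat * d)
  have hev : ∀ z : ℂ, Polynomial.aeval z p = (A : ℂ) * ∑ i, z ^ ((f i % d).toNat * d1) -
    B * ∑ j, z ^ ((g j % d1).toNat * d) := by
    intro z
    simp [p]
  have hp0 : Polynomial.aeval ζ p = 0 := by
    rw [hev, sub_eq_zero]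
    simp_rw [← hζ1, ← hζ2]
    exact h
  have hdpos : (0 : ℤ) < d := by exact_mod_cast hd
  obtain ⟨s, hs1, hs2⟩ := Nat.chineseRemainder hcop (t % d).toNat 1
  have hst : (d : ℤ) ∣ (s : ℤ) - t := by
    have h1 := (Nat.modEq_iff_dvd.mp hs1)
    rw [Int.toNat_of_nonneg (Int.emod_nonneg _ hdpos.ne')] at h1
    have h2 : (d : ℤ) ∣ t - t % d := ⟨t / d, by rw [Int.emod_def]; ring⟩
    have h3 := dvd_add h1 (h2)
    have h4 : (s : ℤ) - t = -((t % d - s) + (t - t % d)) := by ring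
    rw [h4]
    exact (dvd_neg).mpr h3
  have hs1' : (d1 : ℤ) ∣ (s : ℤ) - 1 := by
    have h1 := (Nat.modEq_iff_dvd.mp hs2)
    have h4 : (s : ℤ) - 1 = -(((1 : ℕ) : ℤ) - s) := by push_cast; ring
    rw [h4]
    exact (dvd_neg).mpr h1
  have hsc : Nat.Coprime s (d * d1) := by
    refine Nat.Coprime.mul_right ?_ ?_
    · have : IsCoprime (s : ℤ) d := by
        obtain ⟨q, hq⟩ := hst
        have : (s : ℤ) = t + d * q := by linarith
        rw [this]
        exact ht.add_mul_left_left q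
      exact Nat.isCoprime_iff_coprime.mp this
    · have : IsCoprime (s : ℤ) d1 := by
        obtain ⟨q, hq⟩ := hs1'
        have : (s : ℤ) = 1 + d1 * q := by linarith
        rw [this]
        exact isCoprime_one_left.add_mul_left_left q
      exact Nat.isCoprime_iff_coprime.mp this
  have hps : Polynomial.aeval (ζ ^ s) p = 0 := by
    have hdvd : minpoly ℤ ζ ∣ p :=
      minpoly.isIntegrallyClosed_dvd (hprim.isIntegral (by positivity)) hp0
    rw [hprim.minpoly_eq_pow_coprime hsc] at hdvd
    obtain ⟨q, hq⟩ := hdvd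
    rw [hq, map_mul, minpoly.aeval, zero_mul]
  have hz1 : ∀ m : ℤ, (ζ ^ s) ^ ((m % d).toNat * d1) = ee d (t * m) := by
    intro m
    rw [← pow_mul, mul_comm s, pow_mul, ← hζ1]
    have : ee d m ^ s = ee d (s * m) := by
      unfold ee
      rw [← Complex.exp_nat_mul]
      congr 1
      push_cast
      ring
    rw [this]
    apply ee_congr d hd
    rw [← sub_mul]
    exact hst.mul_right m
  have hz2 : ∀ m : ℤ, (ζ ^ s) ^ ((m % d1).toNat * d) = ee d1 m := by
    intro m
    rw [← pow_mul, mul_comm s, pow_mul, ← hζ2]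
    have : ee d1 m ^ s = ee d1 (s * m) := by
      unfold ee
      rw [← Complex.exp_nat_mul]
      congr 1
      push_cast
      ring
    rw [this]
    apply ee_congr d1 hd1
    have : (s : ℤ) * m - m = (s - 1) * m := by ring
    rw [this]
    exact hs1'.mul_right m
  rw [hev, sub_eq_zero] at hps
  simp_rw [hz1, hz2] at hps
  rw [← h] at hps
  exact mul_left_cancel₀ (by exact_mod_cast hA) hps

/-- The decomposition of `ℤ^n` into residue classes mod `d`. -/
noncomputable def splitEquiv (n d : ℕ) [NeZero d] :
    (Fin n → ZMod d) × (Fin n → ℤ) ≃ (Fin n → ℤ) :=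
  Equiv.ofBijective (fun p i => ((p.1 i).val : ℤ) + d * p.2 i) (by
    have hd : (0 : ℤ) < d := by exact_mod_cast NeZero.pos d
    constructor
    · rintro ⟨r, w⟩ ⟨r', w'⟩ h
      have h1 : ∀ i, ((r i).val : ℤ) + d * w i = ((r' i).val : ℤ) + d * w' i := fun i =>
        congrFun h i
      have h2 : ∀ i, r i = r' i := by
        intro i
        have := congrArg (fun z : ℤ => (z : ZMod d)) (h1 i)
        simpa using this
      have h3 : r = r' := funext h2
      subst h3
      have h4 : w = w' := by
        funext i
        have := h1 i
        have h5 : (d : ℤ) * w i = d * w' i := by linarith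
        exact mul_left_cancel₀ hd.ne' h5
      rw [h4]
    · intro v
      refine ⟨(fun i => (v i : ZMod d), fun i => v i / d), ?_⟩
      funext i
      show (((v i : ZMod d).val : ℤ)) + d * (v i / d) = v i
      rw [ZMod.val_intCast]
      exact Int.emod_add_mul_ediv _ _)

lemma tsum_split {n : ℕ} (d : ℕ) [NeZero d] (F : (Fin n → ℤ) → ℂ) (hF : Summable F) :
    ∑' v, F v = ∑ r : Fin n → ZMod d, ∑' w : Fin n → ℤ,
      F (fun i => ((r i).val : ℤ) + d * w i) := by
  rw [← (splitEquiv n d).tsum_eq F]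
  have hF' : Summable (fun p => F (splitEquiv n d p)) := (splitEquiv n d).summable_iff.mpr hF
  rw [hF'.tsum_prod, tsum_fintype]
  rfl

end ThetaAux


namespace ThetaAux

open Complex

/-- Data extracted from an even positive definite lattice. -/
structure Dat (n k : ℕ) where
  Q : (Fin n → ℤ) → ℤ
  bl : (Fin n → ℤ) → (Fin n → ℤ) → ℤ
  P : Matrix (Fin n) (Fin n) ℝ
  a : (Fin n → ℤ) → ℤ
  T : (Fin n → ℤ) → (Fin n → ℤ)
  h : ℕ
  hn : n = 2 * k
  hP : P.det ≠ 0
  hh : 0 < h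
  Q_add : ∀ v w, Q (v + w) = Q v + Q w + bl v w
  Q_smul : ∀ (m : ℤ) v, Q (m • v) = m ^ 2 * Q v
  bl_smul : ∀ (m : ℤ) v w, bl v (m • w) = m * bl v w
  qP_eq : ∀ v : Fin n → ℤ, qP P (fun i => (v i : ℝ)) = 2 * (Q v : ℝ)
  bl_T : ∀ v u, bl v (T u) = h * ∑ i, u i * v i
  Q_T : ∀ u, 2 * Q (T u) = h * a u
  dot_T : ∀ u, ∑ i, u i * T u i = a u
  qPi_eq : ∀ u : Fin n → ℤ, h * qP (P⁻¹).transpose (fun i => (u i : ℝ)) = (a u : ℝ)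

variable {n k : ℕ}

/-- Integer representative of a residue vector. -/
def vz {n d : ℕ} (r : Fin n → ZMod d) : Fin n → ℤ := fun i => ((r i).val : ℤ)

lemma sum_shift (d : ℕ) [NeZero d] (f : (Fin n → ℤ) → ℂ)
    (hf : ∀ v w : Fin n → ℤ, f (v + (d : ℤ) • w) = f v) (t : Fin n → ℤ) :
    ∑ r : Fin n → ZMod d, f (vz r + t) = ∑ r : Fin n → ZMod d, f (vz r) := by
  rw [← Equiv.sum_comp (Equiv.addRight (fun i => (t i : ZMod d))) (fun r : Fin n → ZMod d => f (vz r))]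
  refine Finset.sum_congr rfl fun r _ => ?_
  have key : ∀ i, ∃ w : ℤ, vz r i + t i =
      vz ((Equiv.addRight (fun i => (t i : ZMod d))) r) i + d * w := by
    intro i
    have : (d : ℤ) ∣ vz r i + t i - vz ((Equiv.addRight (fun i => (t i : ZMod d))) r) i := by
      rw [← ZMod.intCast_zmod_eq_zero_iff_dvd]
      simp [vz]
    obtain ⟨w, hw⟩ := this
    exact ⟨w, by linarith⟩
  choose w hw using key
  rw [← hf (vz ((Equiv.addRight (fun i => (t i : ZMod d))) r)) w]
  congr 1
  funext i
  simp only [Pi.add_apply, Pi.smul_apply, smul_eq_mul]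
  exact hw i

namespace Dat

variable (D : Dat n k)

/-- The theta function. -/
noncomputable def Th (z : ℂ) : ℂ :=
  ∑' v : Fin n → ℤ, cexp (Real.pi * Complex.I * z * (qP D.P (fun i => (v i : ℝ)) : ℝ))

/-- The dual theta function. -/
noncomputable def Thd (z : ℂ) : ℂ :=
  ∑' v : Fin n → ℤ, cexp (Real.pi * Complex.I * z * (qP (D.P⁻¹).transpose (fun i => (v i : ℝ)) : ℝ))

/-- The Gauss sum. -/
noncomputable def G (b : ℤ) (d : ℕ) [NeZero d] : ℂ :=
  ∑ r : Fin n → ZMod d, ee d (b * D.Q (vz r))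

lemma summable_Th (z : ℂ) (hz : 0 < z.im) : Summable fun v : Fin n → ℤ =>
    cexp (Real.pi * Complex.I * z * (qP D.P (fun i => (v i : ℝ)) : ℝ)) := by
  apply Summable.of_norm
  simp_rw [norm_gauss]
  have := summable_qP D.P D.hP (Real.pi * z.im) (by positivity)
  simpa [neg_mul] using this

lemma hPd : (D.P⁻¹).transpose.det ≠ 0 := by
  rw [Matrix.det_transpose, Matrix.det_nonsing_inv]
  simpa using D.hP

lemma Q_shift (v w : Fin n → ℤ) (d : ℤ) : d ∣ D.Q (v + d • w) - D.Q v := by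
  rw [D.Q_add, D.Q_smul, D.bl_smul]
  exact ⟨d * D.Q w + D.bl v w, by ring⟩

lemma cexp_period (z : ℂ) (d : ℕ) [NeZero d] (b : ℤ) (v : Fin n → ℤ) :
    cexp (Real.pi * Complex.I * (b / d + z) * (qP D.P (fun i => (v i : ℝ)) : ℝ)) =
      ee d (b * D.Q v) * cexp (Real.pi * Complex.I * z * (qP D.P (fun i => (v i : ℝ)) : ℝ)) := by
  unfold ee
  rw [← Complex.exp_add, D.qP_eq]
  congr 1
  push_cast
  ring

lemma qP_smul (P : Matrix (Fin n) (Fin n) ℝ) (m : ℝ) (x : Fin n → ℝ) :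
    qP P (m • x) = m ^ 2 * qP P x := by
  unfold qP
  rw [Matrix.mulVec_smul, Finset.mul_sum]
  refine Finset.sum_congr rfl fun i _ => ?_
  simp [mul_pow]

/-- The splitting formula at the rational point `b/d`. -/
lemma split_formula (d : ℕ) [NeZero d] (b : ℤ) (s : ℂ) (hs : 0 < s.im) :
    D.Th (b / d + s) = (|D.P.det⁻¹| : ℝ) * (Complex.I / (d ^ 2 * s)) ^ k *
      ∑' u : Fin n → ℤ, cexp (Real.pi * Complex.I * (-1 / (d ^ 2 * s)) *
        (qP (D.P⁻¹).transpose (fun i => (u i : ℝ)) : ℝ)) *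
        ∑ r : Fin n → ZMod d, ee d (b * D.Q (vz r) + ∑ i, u i * vz r i) := by
  have hd : 0 < d := NeZero.pos d
  have hdc : (d : ℂ) ≠ 0 := by exact_mod_cast hd.ne'
  have him : 0 < (d ^ 2 * s : ℂ).im := by
    have : (d ^ 2 * s : ℂ) = ((d ^ 2 : ℝ) : ℂ) * s := by push_cast; ring
    rw [this, Complex.im_ofReal_mul]
    positivity
  have him2 : 0 < (-1 / (d ^ 2 * s) : ℂ).im := by
    set σ := (d ^ 2 * s : ℂ)
    have h0 : σ ≠ 0 := by
      intro h; rw [h] at him; simp at him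
    have : (-1 / σ : ℂ).im = σ.im / normSq σ := by
      rw [div_eq_mul_inv, neg_one_mul, Complex.neg_im, Complex.inv_im]; ring
    rw [this]
    exact div_pos him (normSq_pos.mpr h0)
  have hsum : Summable fun v : Fin n → ℤ =>
      cexp (Real.pi * Complex.I * (b / d + s) * (qP D.P (fun i => (v i : ℝ)) : ℝ)) := by
    apply D.summable_Th
    have : ((b : ℂ) / d + s).im = s.im := by
      have : ((b : ℂ) / d) = ((b / d : ℝ) : ℂ) := by push_cast; rfl
      rw [this, Complex.add_im, Complex.ofReal_im, zero_add]
    rw [this]; exact hs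
  unfold Th
  rw [tsum_split d _ hsum]
  have h1 : ∀ r : Fin n → ZMod d, ∑' w : Fin n → ℤ,
      cexp (Real.pi * Complex.I * (b / d + s) *
        (qP D.P (fun i => ((((r i).val : ℤ) + d * w i : ℤ) : ℝ)) : ℝ)) =
      ee d (b * D.Q (vz r)) * ((|D.P.det⁻¹| : ℝ) * (Complex.I / (d ^ 2 * s)) ^ k *
      ∑' u : Fin n → ℤ, cexp (Real.pi * Complex.I * (-1 / (d ^ 2 * s)) *
        (qP (D.P⁻¹).transpose (fun i => (u i : ℝ)) : ℝ)) *
          ee d (∑ i, u i * vz r i)) := by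
    intro r
    have h2 : ∀ w : Fin n → ℤ, cexp (Real.pi * Complex.I * (b / d + s) *
        (qP D.P (fun i => ((((r i).val : ℤ) + d * w i : ℤ) : ℝ)) : ℝ)) =
        ee d (b * D.Q (vz r)) * cexp (Real.pi * Complex.I * (d ^ 2 * s) *
          (qP D.P (fun i => (vz r i / d : ℝ) + w i) : ℝ)) := by
      intro w
      rw [D.cexp_period s d b (fun i => ((r i).val : ℤ) + d * w i)]
      congr 1
      · apply ee_congr d hd
        rw [← mul_sub]
        exact (D.Q_shift (vz r) w d).mul_left b
      · have : (fun i => (((((r i).val : ℤ) + d * w i : ℤ)) : ℝ)) =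
            (d : ℝ) • (fun i => (vz r i / d : ℝ) + w i) := by
          funext i
          have : (d : ℝ) ≠ 0 := by exact_mod_cast hd.ne'
          simp only [vz, Pi.smul_apply, smul_eq_mul]
          push_cast
          field_simp
        rw [this, qP_smul]
        congr 1
        push_cast
        ring
    simp_rw [h2]
    rw [tsum_mul_left]
    congr 1
    have := poisson_gauss D.P D.hP k D.hn (d ^ 2 * s) him (fun i => (vz r i / d : ℝ))
    rw [this]
    congr 1
    refine tsum_congr fun u => ?_
    congr 1
    unfold ee
    congr 1
    push_cast
    rw [Finset.sum_div]
    congr 1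
    refine Finset.sum_congr rfl fun i _ => ?_
    ring
  simp_rw [h1]
  have hsm : ∀ r : Fin n → ZMod d, Summable fun u : Fin n → ℤ =>
      cexp (Real.pi * Complex.I * (-1 / (d ^ 2 * s)) *
        (qP (D.P⁻¹).transpose (fun i => (u i : ℝ)) : ℝ)) * ee d (∑ i, u i * vz r i) := by
    intro r
    apply Summable.of_norm
    simp_rw [norm_mul, norm_ee, mul_one, norm_gauss]
    have := summable_qP _ D.hPd (Real.pi * (-1 / (d ^ 2 * s) : ℂ).im) (by positivity)
    simpa [neg_mul] using this
  have h3 : ∀ u : Fin n → ℤ, cexp (Real.pi * Complex.I * (-1 / (d ^ 2 * s)) *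
        (qP (D.P⁻¹).transpose (fun i => (u i : ℝ)) : ℝ)) *
        ∑ r : Fin n → ZMod d, ee d (b * D.Q (vz r) + ∑ i, u i * vz r i) =
        ∑ r : Fin n → ZMod d, ee d (b * D.Q (vz r)) *
        (cexp (Real.pi * Complex.I * (-1 / (d ^ 2 * s)) *
        (qP (D.P⁻¹).transpose (fun i => (u i : ℝ)) : ℝ)) * ee d (∑ i, u i * vz r i)) := by
    intro u
    rw [Finset.mul_sum]
    refine Finset.sum_congr rfl fun r _ => ?_
    rw [ee_add]; ring
  simp_rw [h3]
  rw [Summable.tsum_finsetSum (fun r _ => (hsm r).mul_left _), Finset.mul_sum]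
  refine Finset.sum_congr rfl fun r _ => ?_
  rw [tsum_mul_left]
  ring

/-- Inversion. -/
lemma inversion (z : ℂ) (hz : 0 < z.im) :
    D.Th z = (|D.P.det⁻¹| : ℝ) * (Complex.I / z) ^ k * D.Thd (-1 / z) := by
  have := poisson_gauss D.P D.hP k D.hn z hz 0
  unfold Th Thd
  simpa using this

lemma gauss_shift (d : ℕ) [NeZero d] (a' b c c' : ℤ) (hc : c = 2 * D.h * c')
    (hdet : a' * d - b * c = 1) (u : Fin n → ℤ) :
    ∑ r : Fin n → ZMod d, ee d (b * D.Q (vz r) + ∑ i, u i * vz r i - c' * D.a u) = D.G b d := by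
  have hd : 0 < d := NeZero.pos d
  have hper : ∀ v w : Fin n → ℤ,
      ee d (b * D.Q (v + (d : ℤ) • w) + ∑ i, u i * (v + (d : ℤ) • w) i - c' * D.a u) =
      ee d (b * D.Q v + ∑ i, u i * v i - c' * D.a u) := by
    intro v w
    apply ee_congr d hd
    obtain ⟨q, hq⟩ := D.Q_shift v w d
    refine ⟨b * q + ∑ i, u i * w i, ?_⟩
    have : ∑ i, u i * (v + (d : ℤ) • w) i = ∑ i, u i * v i + d * ∑ i, u i * w i := by
      rw [Finset.mul_sum, ← Finset.sum_add_distrib]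
      refine Finset.sum_congr rfl fun i _ => ?_
      simp only [Pi.add_apply, Pi.smul_apply, smul_eq_mul]
      ring
    rw [this]
    linear_combination b * hq
  rw [← sum_shift d (fun v => ee d (b * D.Q v + ∑ i, u i * v i - c' * D.a u)) hper
    ((2 * c') • D.T u)]
  unfold G
  refine Finset.sum_congr rfl fun r _ => ?_
  apply ee_congr d hd
  have h1 : ∑ i, u i * (vz r + (2 * c') • D.T u) i = ∑ i, u i * vz r i + 2 * c' * D.a u := by
    rw [← D.dot_T, Finset.mul_sum, ← Finset.sum_add_distrib]
    refine Finset.sum_congr rfl fun i _ => ?_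
    simp only [Pi.add_apply, Pi.smul_apply, smul_eq_mul]
    ring
  rw [h1, D.Q_add, D.Q_smul, D.bl_smul, D.bl_T]
  have h2 := D.Q_T u
  refine ⟨a' * (∑ i, u i * vz r i + c' * D.a u), ?_⟩
  subst hc
  linear_combination (2 * b * c' ^ 2) * h2 - (∑ i, u i * vz r i + c' * D.a u) * hdet

lemma im_neg_inv (τ : ℂ) (h : 0 < τ.im) : 0 < (-1 / τ).im := by
  have h0 : τ ≠ 0 := by
    intro h; simp [h] at *
  have : (-1 / τ : ℂ).im = τ.im / normSq τ := by
    rw [div_eq_mul_inv, neg_one_mul, Complex.neg_im, Complex.inv_im]; ring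
  rw [this]
  exact div_pos h (normSq_pos.mpr h0)

lemma denom_ne (c d : ℤ) (hcd : c ≠ 0 ∨ d ≠ 0) (τ : ℂ) (hτ : 0 < τ.im) : (c * τ + d : ℂ) ≠ 0 := by
  intro h
  have h1 := congrArg Complex.im h
  have h2 := congrArg Complex.re h
  simp at h1 h2
  rcases h1 with h1 | h1
  · simp [h1] at h2 hcd
    exact hcd (by exact_mod_cast h2)
  · exact hτ.ne' h1

/-- The transformation formula with Gauss sum. -/
lemma transform (a' b c c' : ℤ) (d : ℕ) [NeZero d] (hc : c = 2 * D.h * c')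
    (hdet : a' * d - b * c = 1) (τ : ℂ) (hτ : 0 < τ.im) :
    D.Th ((a' * τ + b) / (c * τ + d)) = D.G b d * ((c * τ + d) / d) ^ k * D.Th τ := by
  have hd : 0 < d := NeZero.pos d
  have hdc : (d : ℂ) ≠ 0 := by exact_mod_cast hd.ne'
  have hτ0 : τ ≠ 0 := by intro h; simp [h] at hτ
  have hden : (c * τ + d : ℂ) ≠ 0 := by
    have := denom_ne c d (Or.inr (by exact_mod_cast hd.ne')) τ hτ
    simpa using this
  have hdetc : (a' : ℂ) * d - b * c = 1 := by exact_mod_cast hdet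
  set s : ℂ := τ / (d * (c * τ + d)) with hs
  have hs1 : -1 / (d ^ 2 * s) = -(c : ℂ) / d + -1 / τ := by
    rw [hs]; field_simp; ring
  have hs0 : s ≠ 0 := by rw [hs]; positivity
  have hsim : 0 < s.im := by
    have h1 : s = (-1 / (-(c : ℂ) + d * (-1 / τ))) / d := by
      rw [hs]
      have h3 : -(c : ℂ) + d * (-1 / τ) = -((c * τ + d) / τ) := by field_simp; ring
      rw [h3]
      field_simp
    rw [h1, Complex.div_natCast_im]
    refine div_pos (im_neg_inv _ ?_) (by exact_mod_cast hd)
    have := im_neg_inv τ hτ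
    have h2 : (-(c : ℂ) + d * (-1 / τ)).im = d * (-1 / τ).im := by
      rw [Complex.add_im, Complex.neg_im, Complex.intCast_im]
      simp
    rw [h2]
    have : (0 : ℝ) < d := by exact_mod_cast hd
    positivity
  have hγ : (a' * τ + b) / (c * τ + d) = b / d + s := by
    rw [hs, div_add_div _ _ hdc (mul_ne_zero hdc hden),
      div_eq_div_iff hden (mul_ne_zero hdc (mul_ne_zero hdc hden))]
    linear_combination (d * τ * (c * τ + d)) * hdetc
  rw [hγ, D.split_formula d b s hsim, D.inversion τ hτ]
  have hterm : ∀ u : Fin n → ℤ, cexp (Real.pi * Complex.I * (-1 / (d ^ 2 * s)) *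
        (qP (D.P⁻¹).transpose (fun i => (u i : ℝ)) : ℝ)) *
        ∑ r : Fin n → ZMod d, ee d (b * D.Q (vz r) + ∑ i, u i * vz r i) =
        D.G b d * cexp (Real.pi * Complex.I * (-1 / τ) *
        (qP (D.P⁻¹).transpose (fun i => (u i : ℝ)) : ℝ)) := by
    intro u
    have h1 : cexp (Real.pi * Complex.I * (-1 / (d ^ 2 * s)) *
        (qP (D.P⁻¹).transpose (fun i => (u i : ℝ)) : ℝ)) =
        ee d (-(c' * D.a u)) * cexp (Real.pi * Complex.I * (-1 / τ) *
        (qP (D.P⁻¹).transpose (fun i => (u i : ℝ)) : ℝ)) := by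
      unfold ee
      rw [← Complex.exp_add, hs1]
      congr 1
      have h2 : (D.h : ℂ) * (qP (D.P⁻¹).transpose (fun i => (u i : ℝ)) : ℝ) = (D.a u : ℂ) := by
        exact_mod_cast D.qPi_eq u
      push_cast
      rw [← h2]
      rw [hc]
      push_cast
      ring
    rw [h1, ← D.gauss_shift d a' b c c' hc hdet u, mul_right_comm, Finset.mul_sum]
    congr 1
    refine Finset.sum_congr rfl fun r _ => ?_
    rw [← ee_add]
    congr 1
    ring
  simp_rw [hterm]
  rw [tsum_mul_left]
  unfold Thd
  have : (Complex.I / (d ^ 2 * s)) ^ k = ((c * τ + d) / d) ^ k * (Complex.I / τ) ^ k := by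
    rw [← mul_pow]
    congr 1
    rw [hs]
    field_simp
  rw [this]
  ring

end Dat

end ThetaAux


namespace ThetaAux

open Complex

variable {n k : ℕ}

namespace Dat

variable (D : Dat n k)

lemma Th_add_int (z : ℂ) (m : ℤ) : D.Th (z + m) = D.Th z := by
  unfold Th
  refine tsum_congr fun v => ?_
  have := D.cexp_period z 1 m v
  have h1 : ee 1 (m * D.Q v) = 1 := by
    have := ee_mul_self 1 one_pos (m * D.Q v)
    simpa using this
  rw [h1, one_mul] at this
  rw [← this]
  congr 2
  push_cast
  ring

lemma Th_I_ne : D.Th Complex.I ≠ 0 := by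
  have h1 : ∀ v : Fin n → ℤ, cexp (Real.pi * Complex.I * Complex.I * (qP D.P (fun i => (v i : ℝ)) : ℝ)) =
      ((Real.exp (-Real.pi * qP D.P (fun i => (v i : ℝ))) : ℝ) : ℂ) := by
    intro v
    rw [mul_assoc (Real.pi : ℂ) Complex.I Complex.I, I_mul_I]
    push_cast
    congr 1
    ring
  unfold Th
  simp_rw [h1]
  rw [← Complex.ofReal_tsum, Complex.ofReal_ne_zero]
  refine ne_of_gt (Summable.tsum_pos (summable_qP D.P D.hP Real.pi Real.pi_pos)
    (fun v => (Real.exp_pos _).le) 0 (Real.exp_pos _))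

lemma chi_shift (a' b c c' j : ℤ) (d d1 : ℕ) [NeZero d] [NeZero d1] (hc : c = 2 * D.h * c')
    (hdet : a' * d - b * c = 1) (hd1 : (d1 : ℤ) = d + j * c) :
    ((d1 : ℂ)) ^ k * D.G b d = (d : ℂ) ^ k * D.G (b + j * a') d1 := by
  have hdc : (d : ℂ) ≠ 0 := by exact_mod_cast NeZero.ne d
  have hdc1 : (d1 : ℂ) ≠ 0 := by exact_mod_cast NeZero.ne d1
  have hI : 0 < (Complex.I + (j : ℂ)).im := by simp
  have h1 := D.transform a' b c c' d hc hdet (Complex.I + j) hI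
  have hdet1 : a' * d1 - (b + j * a') * c = 1 := by rw [hd1]; linarith
  have h2 := D.transform a' (b + j * a') c c' d1 hc hdet1 Complex.I (by simp)
  have hd1c : (d1 : ℂ) = d + j * c := by exact_mod_cast hd1
  have hden : (c * Complex.I + d1 : ℂ) ≠ 0 := by
    have := denom_ne c d1 (Or.inr (by exact_mod_cast NeZero.ne d1)) Complex.I (by simp)
    simpa using this
  have e1 : (c * (Complex.I + j) + d : ℂ) = c * Complex.I + d1 := by rw [hd1c]; ring
  have e2 : (a' * (Complex.I + j) + b : ℂ) = a' * Complex.I + ((b + j * a' : ℤ) : ℂ) := by push_cast; ring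
  rw [e1, e2, h2, D.Th_add_int, ← e1] at h1
  have h3 := mul_right_cancel₀ D.Th_I_ne h1
  rw [e1, div_pow, div_pow] at h3
  have h4 : (c * Complex.I + d1 : ℂ) ^ k ≠ 0 := pow_ne_zero _ hden
  field_simp at h3
  linear_combination -h3

lemma G_one (b : ℤ) : D.G b 1 = 1 := by
  unfold G
  have : ∀ m : ℤ, ee 1 m = 1 := by
    intro m
    have := ee_mul_self 1 one_pos m
    simpa using this
  simp [this]

lemma G_eq (a' b c : ℤ) (d : ℕ) [NeZero d] (hc : (4 * D.h : ℤ) ∣ c)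
    (hd : (4 * D.h : ℤ) ∣ d - 1) (hdet : a' * d - b * c = 1) :
    D.G b d = (d : ℂ) ^ k := by
  have hdpos : 0 < d := NeZero.pos d
  obtain ⟨c', hc'⟩ := hc
  obtain ⟨m, hm⟩ := hd
  have hcop : IsCoprime (d : ℤ) c := ⟨a', -b, by linarith⟩
  have habs : ((d + c.natAbs : ℕ) : ℤ) = d + c.sign * c := by
    push_cast
    rw [Int.sign_mul_self_eq_natAbs]
    simp
  have : NeZero (d + c.natAbs) := ⟨by omega⟩
  have h1 := D.chi_shift a' b c (2 * c') c.sign d (d + c.natAbs) (by rw [hc']; ring) hdet habs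
  have hcop1 : d.Coprime (d + c.natAbs) := by
    rw [← Nat.isCoprime_iff_coprime, habs, add_comm]
    have : IsCoprime (d : ℤ) (c.sign * c) := by
      have : c.sign * c = ((c.natAbs : ℕ) : ℤ) := Int.sign_mul_self_eq_natAbs c
      rw [this, Nat.isCoprime_iff_coprime]
      have := Int.isCoprime_iff_gcd_eq_one.mp hcop
      simpa [Int.gcd] using this
    simpa using this.add_mul_left_right 1
  have hcopm : IsCoprime m (d : ℤ) := ⟨-(4 * D.h), 1, by linarith⟩
  have ht : IsCoprime (-(c * m)) (d : ℤ) := (hcop.symm.mul_left hcopm).neg_left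
  have h2 := galois d (d + c.natAbs) hdpos (by omega) hcop1 (fun r : Fin n → ZMod d => b * D.Q (vz r))
    (fun r : Fin n → ZMod (d + c.natAbs) => (b + c.sign * a') * D.Q (vz r))
    (((d + c.natAbs : ℕ) : ℤ) ^ k) ((d : ℤ) ^ k)
    (pow_ne_zero _ (by exact_mod_cast NeZero.ne (d + c.natAbs)))
    (by
      have := h1
      unfold G at this
      rw [Int.cast_pow, Int.cast_pow, Int.cast_natCast, Int.cast_natCast]
      exact this) (-(c * m)) ht
  have h3 : D.G b d = D.G m d := by
    unfold G
    rw [← h2]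
    refine Finset.sum_congr rfl fun r _ => ?_
    apply ee_congr d hdpos
    refine ⟨-(a' * m * D.Q (vz r)), ?_⟩
    linear_combination (m * D.Q (vz r)) * hdet
  have h4 := D.chi_shift 1 m (4 * D.h) 2 (-m) d 1 (by ring) (by linarith) (by push_cast; linarith)
  rw [D.G_one] at h4
  rw [h3]
  simpa using h4

/-- The full transformation law. -/
theorem modular (a' b c d : ℤ) (hc : (4 * D.h : ℤ) ∣ c)
    (hd : (4 * D.h : ℤ) ∣ d - 1) (hdet : a' * d - b * c = 1) (τ : ℂ) (hτ : 0 < τ.im) :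
    D.Th ((a' * τ + b) / (c * τ + d)) = (c * τ + d) ^ k * D.Th τ := by
  have key : ∀ (b d : ℤ) (τ : ℂ), 0 < τ.im → 0 < d → (4 * D.h : ℤ) ∣ d - 1 → a' * d - b * c = 1 →
      D.Th ((a' * τ + b) / (c * τ + d)) = (c * τ + d) ^ k * D.Th τ := by
    intro b d τ hτ hdpos hd hdet
    lift d to ℕ using hdpos.le
    have : NeZero d := ⟨by rintro rfl; simp at hdpos⟩
    have hdc : (d : ℂ) ≠ 0 := by exact_mod_cast NeZero.ne d
    obtain ⟨c', hc'⟩ := hc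
    have h1 := D.transform a' b c (2 * c') d (by rw [hc']; ring) hdet τ hτ
    rw [D.G_eq a' b c d ⟨c', hc'⟩ hd hdet, ← mul_pow, mul_div_cancel₀ _ hdc] at h1
    simpa using h1
  have hh := D.hh
  by_cases hc0 : c = 0
  · subst hc0
    have hd1 : d ∣ 1 := ⟨a', by linarith⟩
    rcases Int.isUnit_iff.mp (isUnit_of_dvd_one hd1) with h | h
    · exact key b d τ hτ (by omega) hd hdet
    · exfalso
      subst h
      have := Int.le_of_dvd (by norm_num) ((dvd_neg).mpr hd)
      norm_num at this
      omega
  · set j := c * (|d| + 1) with hj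
    have hpos : 0 < d + j * c := by
      have h1 : 0 < c ^ 2 := by positivity
      have h2 := neg_abs_le d
      have h3 := abs_nonneg d
      rw [hj]
      nlinarith
    have := key (b + j * a') (d + j * c) (τ - j) (by simpa using hτ) hpos
      (by
        have : d + j * c - 1 = (d - 1) + j * c := by ring
        rw [this]
        exact dvd_add hd (hc.mul_left j)) (by linarith)
    have e1 : (c * (τ - j) + ((d + j * c : ℤ) : ℂ)) = c * τ + d := by push_cast; ring
    have e2 : (a' * (τ - j) + ((b + j * a' : ℤ) : ℂ)) = a' * τ + b := by push_cast; ring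
    rw [e1, e2] at this
    rw [this]
    congr 1
    rw [← D.Th_add_int (τ - j) j, sub_add_cancel]

end Dat

end ThetaAux


namespace ThetaAux

open Complex

variable {n k : ℕ}

namespace Dat

variable (D : Dat n k)

lemma Th_bound (z : ℂ) (hz : 1 ≤ z.im) :
    ‖D.Th z‖ ≤ ∑' v : Fin n → ℤ, Real.exp (-Real.pi * qP D.P (fun i => (v i : ℝ))) := by
  refine tsum_of_norm_bounded (summable_qP D.P D.hP Real.pi Real.pi_pos).hasSum fun v => ?_
  rw [norm_gauss, Real.exp_le_exp]
  have h1 := qP_nonneg D.P (fun i => (v i : ℝ))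
  have h2 := Real.pi_pos
  have : Real.pi * qP D.P (fun i => (v i : ℝ)) * 1 ≤ Real.pi * qP D.P (fun i => (v i : ℝ)) * z.im :=
    mul_le_mul_of_nonneg_left hz (by positivity)
  linarith

lemma cusp_pos (a b d : ℤ) (c : ℕ) (hc : 0 < c) (hdet : a * d - b * c = 1) :
    ∃ M : ℝ, ∀ τ : ℂ, 1 ≤ τ.im →
      ‖D.Th ((a * τ + b) / (c * τ + d))‖ ≤ M * ‖(c * τ + d : ℂ)‖ ^ k := by
  have : NeZero c := ⟨hc.ne'⟩
  have hcc : (c : ℂ) ≠ 0 := by exact_mod_cast hc.ne'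
  have hcr : (0 : ℝ) < c := by exact_mod_cast hc
  have hdetc : (a : ℂ) * d - b * c = 1 := by exact_mod_cast hdet
  set S := ∑' u : Fin n → ℤ, Real.exp (-Real.pi * qP (D.P⁻¹).transpose (fun i => (u i : ℝ))) *
    (Fintype.card (Fin n → ZMod c) : ℝ) with hS
  refine ⟨|D.P.det⁻¹| * (1 / c) ^ k * S, fun τ hτ => ?_⟩
  have hτ0 : 0 < τ.im := by linarith
  have hden : (c * τ + d : ℂ) ≠ 0 := by
    have := denom_ne c d (Or.inl (by exact_mod_cast hc.ne')) τ hτ0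
    simpa using this
  set s : ℂ := (-1 / (c * τ + d)) / c with hs
  have hsim : 0 < s.im := by
    rw [hs, Complex.div_natCast_im]
    refine div_pos (im_neg_inv _ ?_) hcr
    have : (c * τ + d : ℂ).im = c * τ.im := by simp
    rw [this]; positivity
  have hγ : (a * τ + b) / (c * τ + d) = a / c + s := by
    rw [hs, div_div, div_add_div _ _ hcc (mul_ne_zero hden hcc),
      div_eq_div_iff hden (mul_ne_zero hcc (mul_ne_zero hden hcc))]
    linear_combination (-c * (c * τ + d)) * hdetc
  have hs1 : -1 / ((c : ℂ) ^ 2 * s) = τ + ((d / c : ℝ) : ℂ) := by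
    rw [hs]; push_cast; field_simp
  have hs2 : ‖Complex.I / ((c : ℂ) ^ 2 * s)‖ = 1 / c * ‖(c * τ + d : ℂ)‖ := by
    have : Complex.I / ((c : ℂ) ^ 2 * s) = -Complex.I * ((1 / c) * (c * τ + d)) := by
      rw [hs]; field_simp
    rw [this, norm_mul, norm_neg, norm_I, one_mul, norm_mul]
    simp
  rw [hγ, D.split_formula c a s hsim, norm_mul, norm_mul, norm_pow, hs2, mul_pow]
  have hb : ‖∑' u : Fin n → ℤ, cexp (Real.pi * Complex.I * (-1 / (c ^ 2 * s)) *
        (qP (D.P⁻¹).transpose (fun i => (u i : ℝ)) : ℝ)) *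
        ∑ r : Fin n → ZMod c, ee c (a * D.Q (vz r) + ∑ i, u i * vz r i)‖ ≤ S := by
    refine tsum_of_norm_bounded
      ((summable_qP _ D.hPd Real.pi Real.pi_pos).mul_right _).hasSum fun u => ?_
    rw [norm_mul]
    refine mul_le_mul ?_ ?_ (norm_nonneg _) (Real.exp_pos _).le
    · rw [norm_gauss, Real.exp_le_exp, hs1, Complex.add_im, Complex.ofReal_im, add_zero]
      have h1 := qP_nonneg (D.P⁻¹).transpose (fun i => (u i : ℝ))
      have h2 := Real.pi_pos
      have : Real.pi * qP (D.P⁻¹).transpose (fun i => (u i : ℝ)) * 1 ≤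
          Real.pi * qP (D.P⁻¹).transpose (fun i => (u i : ℝ)) * τ.im :=
        mul_le_mul_of_nonneg_left hτ (by positivity)
      linarith
    · refine (norm_sum_le _ _).trans ?_
      simp_rw [norm_ee]
      simp
  have hn : ‖((|D.P.det⁻¹| : ℝ) : ℂ)‖ = |D.P.det⁻¹| := by simp
  rw [hn]
  calc |D.P.det⁻¹| * ((1 / (c : ℝ)) ^ k * ‖(c * τ + d : ℂ)‖ ^ k) * _
      ≤ |D.P.det⁻¹| * ((1 / (c : ℝ)) ^ k * ‖(c * τ + d : ℂ)‖ ^ k) * S :=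
        mul_le_mul_of_nonneg_left hb (by positivity)
    _ = _ := by ring

theorem cusp (a b c d : ℤ) (hdet : a * d - b * c = 1) :
    ∃ M : ℝ, ∀ τ : ℂ, 1 ≤ τ.im →
      ‖D.Th ((a * τ + b) / (c * τ + d))‖ ≤ M * ‖(c * τ + d : ℂ)‖ ^ k := by
  rcases lt_trichotomy c 0 with hc | hc | hc
  · obtain ⟨c', hc'⟩ := Int.eq_ofNat_of_zero_le (by omega : 0 ≤ -c)
    obtain ⟨M, hM⟩ := D.cusp_pos (-a) (-b) (-d) c' (by omega) (by rw [← hc']; linarith)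
    refine ⟨M, fun τ hτ => ?_⟩
    have h := hM τ hτ
    have h1 : (c' : ℂ) = -c := by exact_mod_cast hc'.symm
    have e1 : ((c' : ℂ) * τ + ((-d : ℤ) : ℂ)) = -(c * τ + d) := by rw [h1]; push_cast; ring
    have e2 : (((-a : ℤ) : ℂ) * τ + ((-b : ℤ) : ℂ)) = -(a * τ + b) := by push_cast; ring
    rw [e1, e2, neg_div_neg_eq, norm_neg] at h
    exact h
  · subst hc
    refine ⟨∑' v : Fin n → ℤ, Real.exp (-Real.pi * qP D.P (fun i => (v i : ℝ))), fun τ hτ => ?_⟩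
    have hd1 : d ∣ 1 := ⟨a, by linarith⟩
    rcases Int.isUnit_iff.mp (isUnit_of_dvd_one hd1) with h | h
    · subst h
      have ha : a = 1 := by linarith
      subst ha
      have := D.Th_bound (τ + b) (by simpa using hτ)
      simpa using this
    · subst h
      have ha : a = -1 := by linarith
      subst ha
      have := D.Th_bound (τ - b) (by simpa using hτ)
      have e : (((-1 : ℤ) : ℂ) * τ + b) / (((0 : ℤ) : ℂ) * τ + ((-1 : ℤ) : ℂ)) = τ - b := by
        push_cast
        rw [zero_mul, zero_add, div_neg, div_one]; ring
      rw [e]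
      simpa using this
  · obtain ⟨c', rfl⟩ := Int.eq_ofNat_of_zero_le hc.le
    obtain ⟨M, hM⟩ := D.cusp_pos a b d c' (by omega) hdet
    refine ⟨M, fun τ hτ => ?_⟩
    have h := hM τ hτ
    simpa using h

end Dat

end ThetaAux


namespace ThetaAux

open Matrix

lemma formR_eq (L : EvenLattice) (R : Type*) [CommRing R] (x y : Fin L.n → R) :
    formR L R x y = x ⬝ᵥ (L.B.map (Int.cast : ℤ → R)) *ᵥ y := by
  unfold formR dotProduct mulVec dotProduct
  refine Finset.sum_congr rfl fun i _ => ?_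
  rw [Finset.mul_sum]
  refine Finset.sum_congr rfl fun j _ => ?_
  simp only [Matrix.map_apply]
  ring

lemma formR_comm (L : EvenLattice) (v w : Fin L.n → ℤ) : formR L ℤ v w = formR L ℤ w v := by
  unfold formR
  rw [Finset.sum_comm]
  refine Finset.sum_congr rfl fun i _ => Finset.sum_congr rfl fun j _ => ?_
  rw [← L.symm.apply i j]
  ring

lemma formR_even (L : EvenLattice) (v : Fin L.n → ℤ) : 2 ∣ formR L ℤ v v := by
  have h : ((formR L ℤ v v : ℤ) : ZMod 2) = 0 := by
    have e : formR L ℤ v v = ∑ p : Fin L.n × Fin L.n, L.B p.1 p.2 * v p.1 * v p.2 :=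
      (Fintype.sum_prod_type' (fun i j => L.B i j * v i * v j)).symm
    rw [e, Int.cast_sum]
    refine Finset.sum_involution (fun p _ => (p.2, p.1)) ?_ ?_ ?_ ?_
    · rintro ⟨i, j⟩ _
      simp only
      rw [← L.symm.apply i j, ← Int.cast_add]
      rw [show L.B j i * v i * v j + L.B j i * v j * v i = 2 * (L.B j i * v i * v j) by ring]
      push_cast
      rw [show (2 : ZMod 2) = 0 from rfl, zero_mul]
    · rintro ⟨i, j⟩ _ hne heq
      simp only [Prod.mk.injEq] at heq
      obtain ⟨rfl, _⟩ := heq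
      apply hne
      simp only
      obtain ⟨m, hm⟩ := L.even_diag j
      rw [hm]
      push_cast
      rw [show (2 : ZMod 2) = 0 from rfl]
      ring
    · simp
    · simp
  exact (ZMod.intCast_zmod_eq_zero_iff_dvd _ 2).mp h

lemma formR_self_add (L : EvenLattice) (v w : Fin L.n → ℤ) :
    formR L ℤ (v + w) (v + w) = formR L ℤ v v + formR L ℤ w w + 2 * formR L ℤ v w := by
  have h1 : formR L ℤ w v = formR L ℤ v w := formR_comm L w v
  rw [formR_add_left, formR_comm L v (v + w), formR_comm L w (v + w), formR_add_left,
    formR_add_left, h1]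
  ring

lemma formR_smul_right (L : EvenLattice) (m : ℤ) (v w : Fin L.n → ℤ) :
    formR L ℤ v (m • w) = m * formR L ℤ v w := by
  unfold formR
  rw [Finset.mul_sum]
  refine Finset.sum_congr rfl fun i _ => ?_
  rw [Finset.mul_sum]
  refine Finset.sum_congr rfl fun j _ => ?_
  simp only [Pi.smul_apply, smul_eq_mul]
  ring

lemma formR_cast (L : EvenLattice) (v : Fin L.n → ℤ) :
    formR L ℝ (fun i => (v i : ℝ)) (fun i => (v i : ℝ)) = (formR L ℤ v v : ℝ) := by
  unfold formR
  push_cast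
  rfl

lemma exists_sqrt (L : EvenLattice)
    (hpos : ∀ x : Fin L.n → ℝ, x ≠ 0 → 0 < formR L ℝ x x) :
    ∃ P : Matrix (Fin L.n) (Fin L.n) ℝ, L.B.map (Int.cast : ℤ → ℝ) = Pᵀ * P := by
  open scoped MatrixOrder in
  have hpd : (L.B.map (Int.cast : ℤ → ℝ)).PosDef := by
    refine Matrix.PosDef.of_dotProduct_mulVec_pos ?_ fun x hx => ?_
    · ext i j
      simp [Matrix.conjTranspose_apply, L.symm.apply]
    · have := hpos x hx
      rw [formR_eq] at this
      simpa using this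
  open scoped MatrixOrder in
  obtain ⟨P, hP⟩ := CStarAlgebra.nonneg_iff_eq_star_mul_self.mp hpd.posSemidef.nonneg
  refine ⟨P, ?_⟩
  rw [hP, star_eq_conjTranspose, conjTranspose_eq_transpose_of_trivial]

lemma qP_eq_dot {n : ℕ} (P : Matrix (Fin n) (Fin n) ℝ) (x : Fin n → ℝ) :
    qP P x = x ⬝ᵥ (Pᵀ * P) *ᵥ x := by
  unfold qP
  rw [← Matrix.mulVec_mulVec, Matrix.dotProduct_mulVec, Matrix.vecMul_transpose]
  unfold dotProduct
  refine Finset.sum_congr rfl fun i _ => ?_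
  ring

lemma exists_dat (L : EvenLattice)
    (hpos : ∀ x : Fin L.n → ℝ, x ≠ 0 → 0 < formR L ℝ x x) (k : ℕ) (hk : L.n = 2 * k) :
    ∃ D : Dat L.n k, ∀ v, (formR L ℤ v v : ℝ) = qP D.P (fun i => (v i : ℝ)) := by
  obtain ⟨P, hP⟩ := exists_sqrt L hpos
  have hdetB : (L.B.map (Int.cast : ℤ → ℝ)).det ≠ 0 := by
    have : (L.B.map (Int.cast : ℤ → ℝ)).det = ((L.B.det : ℤ) : ℝ) := by
      have := (Int.castRingHom ℝ).map_det L.B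
      rw [eq_comm]; simpa using this
    rw [this]
    exact_mod_cast L.nondeg
  have hPdet : P.det ≠ 0 := by
    intro h
    apply hdetB
    rw [hP, det_mul, h, mul_zero]
  set A : Matrix (Fin L.n) (Fin L.n) ℤ := L.B.det.sign • L.B.adjugate with hA
  have hBA : L.B * A = (L.B.det.natAbs : ℤ) • (1 : Matrix (Fin L.n) (Fin L.n) ℤ) := by
    rw [hA, Matrix.mul_smul, Matrix.mul_adjugate, smul_smul, Int.sign_mul_self_eq_natAbs]
  have hform : ∀ v, (formR L ℤ v v : ℝ) = qP P (fun i => (v i : ℝ)) := by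
    intro v
    rw [← formR_cast, formR_eq, qP_eq_dot, hP]
  have hQ : ∀ v, 2 * (formR L ℤ v v / 2) = formR L ℤ v v := fun v =>
    Int.mul_ediv_cancel' (formR_even L v)
  have hblT : ∀ v u, formR L ℤ v (A *ᵥ u) = (L.B.det.natAbs : ℤ) * ∑ i, u i * v i := by
    intro v u
    rw [formR_eq]
    have : L.B.map (Int.cast : ℤ → ℤ) = L.B := by ext i j; simp
    rw [this, Matrix.mulVec_mulVec, hBA, Matrix.smul_mulVec, Matrix.one_mulVec,
      dotProduct_smul, smul_eq_mul]
    congr 1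
    unfold dotProduct
    exact Finset.sum_congr rfl fun i _ => mul_comm _ _
  refine ⟨{ Q := fun v => formR L ℤ v v / 2
            bl := formR L ℤ
            P := P
            a := fun u => ∑ i, u i * (A *ᵥ u) i
            T := fun u => A *ᵥ u
            h := L.B.det.natAbs
            hn := hk
            hP := hPdet
            hh := Int.natAbs_pos.mpr L.nondeg
            Q_add := ?_
            Q_smul := ?_
            bl_smul := formR_smul_right L
            qP_eq := ?_
            bl_T := hblT
            Q_T := ?_
            dot_T := fun _ => rfl
            qPi_eq := ?_ }, hform⟩
  · intro v w
    have := formR_self_add L v w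
    have h1 := hQ v
    have h2 := hQ w
    have h3 := hQ (v + w)
    linarith
  · intro m v
    have h1 := hQ v
    have h2 := hQ (m • v)
    rw [formR_smul_right, formR_comm L (m • v) v, formR_smul_right] at h2
    rw [formR_smul_right, formR_comm L (m • v) v, formR_smul_right]
    have : 2 * (m * (m * formR L ℤ v v) / 2) = 2 * (m ^ 2 * (formR L ℤ v v / 2)) := by
      rw [h2]
      linear_combination (-m ^ 2) * h1
    linarith
  · intro v
    rw [← hform]
    exact_mod_cast (hQ v).symm
  · intro u
    rw [hQ, hblT]
  · intro u
    have hAR : (L.B.map (Int.cast : ℤ → ℝ)) * (A.map (Int.cast : ℤ → ℝ)) =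
        (L.B.det.natAbs : ℝ) • (1 : Matrix (Fin L.n) (Fin L.n) ℝ) := by
      have h1 := congrArg (fun M : Matrix (Fin L.n) (Fin L.n) ℤ => M.map (Int.castRingHom ℝ)) hBA
      simp only [Matrix.map_mul] at h1
      have h2 : ((L.B.det.natAbs : ℤ) • (1 : Matrix (Fin L.n) (Fin L.n) ℤ)).map (Int.castRingHom ℝ)
          = (L.B.det.natAbs : ℝ) • (1 : Matrix (Fin L.n) (Fin L.n) ℝ) := by
        ext i j
        rw [Matrix.map_apply, Matrix.smul_apply, Matrix.smul_apply, Matrix.one_apply,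
          Matrix.one_apply]
        split_ifs <;> simp
      rw [h2] at h1
      exact h1
    have hu : IsUnit P.det := isUnit_iff_ne_zero.mpr hPdet
    have hinv : P⁻¹ * (P⁻¹)ᵀ * (L.B.map (Int.cast : ℤ → ℝ)) = 1 := by
      rw [hP, Matrix.transpose_nonsing_inv]
      have hu' : IsUnit (Pᵀ).det := by rw [det_transpose]; exact hu
      calc P⁻¹ * (Pᵀ)⁻¹ * (Pᵀ * P) = P⁻¹ * ((Pᵀ)⁻¹ * Pᵀ) * P := by
            simp only [Matrix.mul_assoc]
        _ = 1 := by rw [Matrix.nonsing_inv_mul _ hu', Matrix.mul_one, Matrix.nonsing_inv_mul _ hu]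
    have hAeq : A.map (Int.cast : ℤ → ℝ) = (L.B.det.natAbs : ℝ) • (P⁻¹ * (P⁻¹)ᵀ) := by
      calc A.map (Int.cast : ℤ → ℝ) = (P⁻¹ * (P⁻¹)ᵀ * (L.B.map (Int.cast : ℤ → ℝ))) *
            A.map (Int.cast : ℤ → ℝ) := by rw [hinv, Matrix.one_mul]
        _ = _ := by rw [Matrix.mul_assoc, hAR, Matrix.mul_smul, Matrix.mul_one]
    rw [qP_eq_dot, Matrix.transpose_transpose, ← smul_eq_mul, ← dotProduct_smul,
      ← Matrix.smul_mulVec, ← hAeq]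
    unfold mulVec dotProduct
    push_cast
    rfl

end ThetaAux

namespace ThetaAux

open Complex

lemma exp_le_aux {n : ℕ} (P : Matrix (Fin n) (Fin n) ℝ) (δ : ℝ) (z : ℂ) (hz : δ ≤ z.im)
    (v : Fin n → ℤ) :
    ‖cexp (Real.pi * Complex.I * z * (qP P (fun i => (v i : ℝ)) : ℝ))‖ ≤
      Real.exp (-(Real.pi * δ) * qP P (fun i => (v i : ℝ))) := by
  rw [norm_gauss, Real.exp_le_exp]
  have h1 := qP_nonneg P (fun i => (v i : ℝ))
  have h2 := Real.pi_pos
  have : Real.pi * qP P (fun i => (v i : ℝ)) * δ ≤ Real.pi * qP P (fun i => (v i : ℝ)) * z.im :=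
    mul_le_mul_of_nonneg_left hz (by positivity)
  linarith

lemma Dat.differentiableAt {n k : ℕ} (D : Dat n k) (z : ℂ) (hz : 0 < z.im) :
    DifferentiableAt ℂ D.Th z := by
  have hopen : IsOpen {w : ℂ | z.im / 2 < w.im} := isOpen_lt continuous_const Complex.continuous_im
  have h : DifferentiableOn ℂ D.Th {w : ℂ | z.im / 2 < w.im} := by
    unfold Dat.Th
    refine differentiableOn_tsum_of_summable_norm
      (u := fun v : Fin n → ℤ => Real.exp (-(Real.pi * (z.im / 2)) * qP D.P (fun i => (v i : ℝ))))
      (summable_qP D.P D.hP _ (by positivity)) (fun v => ?_) hopen (fun v w hw => ?_)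
    · fun_prop
    · exact exp_le_aux D.P _ w (le_of_lt hw) v
  exact h.differentiableAt (hopen.mem_nhds (by
    show z.im / 2 < z.im
    linarith))

end ThetaAux

/-- **Theta series of positive definite even lattices are modular forms.**
For a positive definite even lattice `L` of even rank `n`, the theta series converges
absolutely and locally uniformly on the upper half-plane, and for some `N ≥ 1` it agrees
with a modular form of weight `n/2` for `Γ(N)` (which is holomorphic, transforms with
automorphy factor `(cτ+d)^{n/2}` under `Γ(N)`, and is holomorphic at the cusps); in
particular the transformation law holds for every element of `Γ(N)`. -/
theorem theta_series_modular_form (L : EvenLattice)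
    (hpos : ∀ x : Fin L.n → ℝ, x ≠ 0 → 0 < formR L ℝ x x) (heven : Even L.n) :
    (∀ τ : UpperHalfPlane, Summable (fun v : Fin L.n → ℤ =>
      ‖Complex.exp (Real.pi * Complex.I * ((formR L ℤ v v : ℤ) : ℂ) * (τ : ℂ))‖)) ∧
    TendstoLocallyUniformly
      (fun (s : Finset (Fin L.n → ℤ)) (τ : UpperHalfPlane) =>
        ∑ v ∈ s, Complex.exp (Real.pi * Complex.I * ((formR L ℤ v v : ℤ) : ℂ) * (τ : ℂ)))
      (thetaSeries L) atTop ∧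
    ∃ N : ℕ, 1 ≤ N ∧
      (∀ γ ∈ CongruenceSubgroup.Gamma N, ∀ τ : UpperHalfPlane,
        thetaSeries L (γ • τ) =
          (((γ : Matrix (Fin 2) (Fin 2) ℤ) 1 0 : ℂ) * (τ : ℂ) +
            ((γ : Matrix (Fin 2) (Fin 2) ℤ) 1 1 : ℂ)) ^ ((L.n : ℤ) / 2) * thetaSeries L τ) ∧
      ∃ F : ModularForm (CongruenceSubgroup.Gamma N) ((L.n : ℤ) / 2),
        ∀ τ : UpperHalfPlane, F τ = thetaSeries L τ := by
  obtain ⟨k, hk'⟩ := heven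
  have hk : L.n = 2 * k := by omega
  have hwt : (L.n : ℤ) / 2 = (k : ℤ) := by omega
  obtain ⟨D, hD⟩ := ThetaAux.exists_dat L hpos k hk
  have hterm : ∀ (v : Fin L.n → ℤ) (z : ℂ),
      Complex.exp (Real.pi * Complex.I * ((formR L ℤ v v : ℤ) : ℂ) * z) =
      Complex.exp (Real.pi * Complex.I * z * (ThetaAux.qP D.P (fun i => (v i : ℝ)) : ℝ)) := by
    intro v z
    have : ((formR L ℤ v v : ℤ) : ℂ) = (ThetaAux.qP D.P (fun i => (v i : ℝ)) : ℝ) := by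
      rw [← hD v]; push_cast; rfl
    rw [this]
    congr 1
    ring
  have hTh : ∀ τ : UpperHalfPlane, thetaSeries L τ = D.Th τ := by
    intro τ
    unfold thetaSeries ThetaAux.Dat.Th
    simp_rw [hterm]
  have hsmul : ∀ (γ : Matrix.SpecialLinearGroup (Fin 2) ℤ) (τ : UpperHalfPlane),
      ((γ • τ : UpperHalfPlane) : ℂ) = (((γ 0 0 : ℤ) : ℂ) * τ + ((γ 0 1 : ℤ) : ℂ)) /
        (((γ 1 0 : ℤ) : ℂ) * τ + ((γ 1 1 : ℤ) : ℂ)) := by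
    intro γ τ
    rw [UpperHalfPlane.specialLinearGroup_apply]
    simp
  have hdet : ∀ γ : Matrix.SpecialLinearGroup (Fin 2) ℤ,
      γ 0 0 * γ 1 1 - γ 0 1 * γ 1 0 = 1 := by
    intro γ
    rw [← Matrix.det_fin_two]
    exact γ.det_coe
  have hmod : ∀ γ ∈ CongruenceSubgroup.Gamma (4 * D.h), ∀ τ : UpperHalfPlane,
        thetaSeries L (γ • τ) =
          (((γ : Matrix (Fin 2) (Fin 2) ℤ) 1 0 : ℂ) * (τ : ℂ) +
            ((γ : Matrix (Fin 2) (Fin 2) ℤ) 1 1 : ℂ)) ^ ((L.n : ℤ) / 2) * thetaSeries L τ := by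
    intro γ hγ τ
    rw [CongruenceSubgroup.Gamma_mem] at hγ
    obtain ⟨_, _, h10, h11⟩ := hγ
    have hc : (4 * D.h : ℤ) ∣ γ 1 0 := by
      have := (ZMod.intCast_zmod_eq_zero_iff_dvd _ _).mp h10
      exact_mod_cast this
    have hd : (4 * D.h : ℤ) ∣ γ 1 1 - 1 := by
      have : ((γ 1 1 - 1 : ℤ) : ZMod (4 * D.h)) = 0 := by
        rw [Int.cast_sub, h11]; simp
      have := (ZMod.intCast_zmod_eq_zero_iff_dvd _ _).mp this
      exact_mod_cast this
    rw [hTh, hTh, hsmul, hwt, zpow_natCast]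
    exact D.modular _ _ _ _ hc hd (hdet γ) τ τ.im_pos
  refine ⟨fun τ => ?_, ?_, 4 * D.h, by have := D.hh; omega, hmod, ?_⟩
  · simp_rw [hterm]
    exact (D.summable_Th τ τ.im_pos).norm
  · intro u hu τ
    have hopen : IsOpen {w : UpperHalfPlane | τ.im / 2 < w.im} :=
      isOpen_lt continuous_const UpperHalfPlane.continuous_im
    have hunif := tendstoUniformlyOn_tsum (s := {w : UpperHalfPlane | τ.im / 2 < w.im})
      (f := fun (v : Fin L.n → ℤ) (w : UpperHalfPlane) =>
        Complex.exp (Real.pi * Complex.I * ((formR L ℤ v v : ℤ) : ℂ) * (w : ℂ)))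
      (ThetaAux.summable_qP D.P D.hP (Real.pi * (τ.im / 2))
        (by have := τ.im_pos; positivity))
      (fun v w hw => by
        rw [hterm]
        exact ThetaAux.exp_le_aux D.P _ w (le_of_lt hw) v)
    refine ⟨{w : UpperHalfPlane | τ.im / 2 < w.im}, hopen.mem_nhds (by
      show τ.im / 2 < τ.im
      have := τ.im_pos
      linarith), ?_⟩
    exact hunif u hu
  · have : NeZero (4 * D.h) := ⟨by have := D.hh; omega⟩
    refine ⟨{ toFun := thetaSeries L
              slash_action_eq' := ?_
              holo' := ?_
              bdd_at_cusps' := ?_ }, fun τ => rfl⟩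
    · rintro _ ⟨γ, hγ, rfl⟩
      funext τ
      have h1 := ModularForm.SL_slash_apply (f := thetaSeries L) (k := (L.n : ℤ) / 2) γ τ
      have h2 := hmod γ hγ τ
      have h3 : UpperHalfPlane.denom γ τ = (((γ : Matrix (Fin 2) (Fin 2) ℤ) 1 0 : ℂ) * (τ : ℂ) +
            ((γ : Matrix (Fin 2) (Fin 2) ℤ) 1 1 : ℂ)) := by
        simp [UpperHalfPlane.denom]
      have h4 := UpperHalfPlane.denom_ne_zero (γ : GL (Fin 2) ℝ) τ
      rw [h2, ← h3, mul_right_comm, ← zpow_add₀ h4] at h1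
      simp only [add_neg_cancel, zpow_zero, one_mul] at h1
      exact h1
    · rw [UpperHalfPlane.mdifferentiable_iff]
      have : DifferentiableOn ℂ D.Th {z : ℂ | 0 < z.im} := fun z hz =>
        (D.differentiableAt z hz).differentiableWithinAt
      refine this.congr fun z hz => ?_
      show thetaSeries L (UpperHalfPlane.ofComplex z) = D.Th z
      rw [hTh, UpperHalfPlane.ofComplex_apply_of_im_pos hz]
    · intro c hc
      rw [Subgroup.IsArithmetic.isCusp_iff_isCusp_SL2Z] at hc
      rw [OnePoint.isBoundedAt_iff_forall_SL2Z hc]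
      intro γ _
      rw [UpperHalfPlane.isBoundedAtImInfty_iff]
      obtain ⟨M, hM⟩ := D.cusp (γ 0 0) (γ 0 1) (γ 1 0) (γ 1 1) (hdet γ)
      refine ⟨M, 1, fun τ hτ => ?_⟩
      have h1 := ModularForm.SL_slash_apply (f := thetaSeries L) (k := (L.n : ℤ) / 2) γ τ
      have h3 : UpperHalfPlane.denom γ τ = (((γ : Matrix (Fin 2) (Fin 2) ℤ) 1 0 : ℂ) * (τ : ℂ) +
            ((γ : Matrix (Fin 2) (Fin 2) ℤ) 1 1 : ℂ)) := by
        simp [UpperHalfPlane.denom]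
      have h4 := UpperHalfPlane.denom_ne_zero (γ : GL (Fin 2) ℝ) τ
      have h5 := hM τ hτ
      rw [← hsmul, ← h3, ← hTh] at h5
      rw [h1, hwt, zpow_neg, zpow_natCast, norm_mul, norm_inv, norm_pow]
      have h6 : 0 < ‖UpperHalfPlane.denom γ τ‖ ^ k := by
        have := norm_pos_iff.mpr h4
        positivity
      rw [← div_eq_mul_inv, div_le_iff₀ h6]
      exact h5
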